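/- Fix an increasing sequence (k_n)_{n≥1} of positive integers with k_n ≤ n for all n and k_n → ∞, and set rat_n = B_{n−1,k_n}/B_{n,k_n}. Then the probability P_n⟨false⟩ that a uniformly random equivalence class of and/or trees of size n (using at most k_n distinct variables) computes the constant function false satisfies, asymptotically as n → ∞, P_n⟨false⟩ ∼ (3/4)·rat_n; and by duality the same asymptotics holds for P_n⟨true⟩. -/

import Mathlib

open Filter

namespace CatalanSat

/-- A logical connective: `and` or `or`. -/
inductive Conn : Type
  | and : Conn
  | or : Conn

/-- An and/or tree: a binary plane tree with internal nodes labelled by a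
connective and leaves labelled by a literal `(v, b)`: variable `v`, positive
if `b = true`, negated if `b = false`. -/
inductive AOTree : Type
  | leaf (v : ℕ) (b : Bool) : AOTree
  | node (c : Conn) (l r : AOTree) : AOTree

namespace AOTree

/-- The list of leaf labels (variable index, polarity), from left to right. -/
def leaves : AOTree → List (ℕ × Bool)
  | .leaf v b => [(v, b)]
  | .node _ l r => leaves l ++ leaves r

/-- The size of an and/or tree is its number of leaves. -/
def size (t : AOTree) : ℕ := t.leaves.length

/-- The number of distinct variables appearing as leaf labels. -/
def varCount (t : AOTree) : ℕ := (t.leaves.map Prod.fst).toFinset.card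

/-- The Boolean function computed by an and/or tree. -/
def eval : AOTree → (ℕ → Bool) → Bool
  | .leaf v b, x => if b then x v else !(x v)
  | .node .and l r, x => eval l x && eval r x
  | .node .or l r, x => eval l x || eval r x

end AOTree

/-- A tree-structure: a binary plane tree with internal nodes labelled by a
connective and unlabelled leaves. -/
inductive Shape : Type
  | leaf : Shape
  | node (c : Conn) (l r : Shape) : Shape

/-- The size of a tree-structure is its number of leaves. -/
def Shape.size : Shape → ℕ
  | .leaf => 1
  | .node _ l r => Shape.size l + Shape.size r

/-- The tree-structure of an and/or tree (forget the leaf labels). -/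
def AOTree.shape : AOTree → Shape
  | .leaf _ _ => .leaf
  | .node c l r => .node c l.shape r.shape

/-- The label of the `i`-th leaf (junk default when out of range). -/
def lv (t : AOTree) (i : ℕ) : ℕ × Bool := t.leaves.getD i (0, true)

/-- Two and/or trees are equivalent when they have the same tree-structure,
two leaves are labelled by the same variable in one iff they are in the other,
and two leaves are labelled by the same literal in one iff they are in the other. -/
def TreeEquiv (A B : AOTree) : Prop :=
  A.shape = B.shape ∧
  ∀ i j : ℕ, i < A.leaves.length → j < A.leaves.length →
    (((lv A i).1 = (lv A j).1) ↔ ((lv B i).1 = (lv B j).1)) ∧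
    ((lv A i = lv A j) ↔ (lv B i = lv B j))

/-- The equivalence relation on Boolean functions induced by equivalence of trees. -/
def FunEquiv (f g : (ℕ → Bool) → Bool) : Prop :=
  ∃ A B : AOTree, TreeEquiv A B ∧ A.eval = f ∧ B.eval = g

/-- The number of equivalence classes of and/or trees satisfying a property
(the property being assumed invariant under equivalence). -/
noncomputable def classCount (P : AOTree → Prop) : ℕ :=
  Nat.card (Quot (fun A B : {t : AOTree // P t} => TreeEquiv A.1 B.1))

/-- `Tcount n K`: number of equivalence classes of and/or trees of size `n`
using at most `K` distinct variables. -/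
noncomputable def Tcount (n K : ℕ) : ℕ := classCount fun t => t.size = n ∧ t.varCount ≤ K

/-- Number of such classes computing a function of the class `⟨f⟩`. -/
noncomputable def TcountClass (n K : ℕ) (f : (ℕ → Bool) → Bool) : ℕ :=
  classCount fun t => t.size = n ∧ t.varCount ≤ K ∧ FunEquiv t.eval f

/-- `P_n⟨f⟩`: the probability that a uniform equivalence class of trees of size
`n` (at most `K` variables) computes a function of `⟨f⟩`. -/
noncomputable def Pclass (n K : ℕ) (f : (ℕ → Bool) → Bool) : ℝ :=
  (TcountClass n K f : ℝ) / (Tcount n K : ℝ)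

/-- Number of classes of size `n`, at most `K` variables, computing exactly `f`. -/
noncomputable def TcountEval (n K : ℕ) (f : (ℕ → Bool) → Bool) : ℕ :=
  classCount fun t => t.size = n ∧ t.varCount ≤ K ∧ t.eval = f

/-- Stirling numbers of the second kind. -/
def stirling : ℕ → ℕ → ℕ
  | 0, 0 => 1
  | 0, _ + 1 => 0
  | _ + 1, 0 => 0
  | n + 1, k + 1 => (k + 1) * stirling n (k + 1) + stirling n k

/-- `B n k = Σ_{p=1}^{k} S(n,p)·2^{−p}`. -/
noncomputable def B (n k : ℕ) : ℝ :=
  ∑ p ∈ Finset.Icc 1 k, (stirling n p : ℝ) / 2 ^ p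

/-- `a n p = p^n/(p!·2^p)`. -/
noncomputable def a (n p : ℕ) : ℝ :=
  (p : ℝ) ^ n / ((Nat.factorial p : ℝ) * 2 ^ p)

/-- `rat_n = B_{n−1,k_n}/B_{n,k_n}`. -/
noncomputable def rat (k : ℕ → ℕ) (n : ℕ) : ℝ := B (n - 1) (k n) / B n (k n)

/-- The complexity `L(f)`: minimal size of an and/or tree computing `f`. -/
noncomputable def complexity (f : (ℕ → Bool) → Bool) : ℕ :=
  sInf {m | ∃ t : AOTree, t.size = m ∧ t.eval = f}

/-- The variable `x_i` is essential for `f`. -/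
def Essential (i : ℕ) (f : (ℕ → Bool) → Bool) : Prop :=
  ∃ x : ℕ → Bool, f (Function.update x i false) ≠ f (Function.update x i true)

/-- `E(f)`: the number of essential variables of `f`. -/
noncomputable def essCount (f : (ℕ → Bool) → Bool) : ℕ :=
  Nat.card {i : ℕ // Essential i f}

/-- The multiplicity `R⟨f⟩ = L⟨f⟩ − E⟨f⟩`. -/
noncomputable def mult (f : (ℕ → Bool) → Bool) : ℕ := complexity f - essCount f

/-- `M` is, for each `n ≥ 1`, an index of `{1,…,n}` maximizing `p ↦ p^n/(p!·2^p)`. -/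
def IsArgmax (M : ℕ → ℕ) : Prop :=
  ∀ n, 1 ≤ n → M n ∈ Finset.Icc 1 n ∧ ∀ p ∈ Finset.Icc 1 n, a n p ≤ a n (M n)

/-- There is a leaf labelled by the given literal linked to the root by
`∨`-labelled internal nodes only. -/
def orLeaf : AOTree → ℕ × Bool → Prop
  | .leaf v b, l => (v, b) = l
  | .node .or A B, l => orLeaf A l ∨ orLeaf B l
  | .node .and _ _, _ => False

/-- There is a leaf labelled by the given literal linked to the root by
`∧`-labelled internal nodes only. -/
def andLeaf : AOTree → ℕ × Bool → Prop
  | .leaf v b, l => (v, b) = l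
  | .node .and A B, l => andLeaf A l ∨ andLeaf B l
  | .node .or _ _, _ => False

/-- A simple tautology: two leaves labelled by a variable and its negation,
both linked to the root through `∨`-connectives only. -/
def IsSimpleTautology (t : AOTree) : Prop :=
  ∃ v b, orLeaf t (v, b) ∧ orLeaf t (v, !b)

/-- A simple contradiction: the dual notion. -/
def IsSimpleContradiction (t : AOTree) : Prop :=
  ∃ v b, andLeaf t (v, b) ∧ andLeaf t (v, !b)

/-- A tautology: a tree computing the constant function `true`. -/
def IsTautology (t : AOTree) : Prop := ∀ x : ℕ → Bool, t.eval x = true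

/-- A simple-x of type T: one subtree of the root is a single leaf, the other
is a simple tautology if the root is `∧`, a simple contradiction if it is `∨`. -/
def IsSimpleXT (t : AOTree) : Prop :=
  (∃ v b s, (t = .node .and (.leaf v b) s ∨ t = .node .and s (.leaf v b)) ∧
    IsSimpleTautology s) ∨
  (∃ v b s, (t = .node .or (.leaf v b) s ∨ t = .node .or s (.leaf v b)) ∧
    IsSimpleContradiction s)

/-- A simple-x of type X: one subtree of the root is a single leaf `ℓ`, the root
is `∧` (resp. `∨`), and the other subtree has a leaf labelled by the literal of
`ℓ` linked to its root by `∨`-only (resp. `∧`-only) internal nodes. -/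
def IsSimpleXX (t : AOTree) : Prop :=
  (∃ v b s, (t = .node .and (.leaf v b) s ∨ t = .node .and s (.leaf v b)) ∧
    orLeaf s (v, b)) ∨
  (∃ v b s, (t = .node .or (.leaf v b) s ∨ t = .node .or s (.leaf v b)) ∧
    andLeaf s (v, b))

namespace Shape

theorem size_pos (s : Shape) : 0 < s.size := by
  induction s with
  | leaf => simp [size]
  | node c l r ihl ihr => simp only [size]; omega

theorem finite_setOf_size_eq (n : ℕ) : {s : Shape | s.size = n}.Finite := by
  induction n using Nat.strong_induction_on with
  | _ n ih =>
    have hfin : ∀ c, (⋃ i ∈ Finset.range n, ⋃ j ∈ Finset.range n,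
        Set.image2 (node c) {s : Shape | s.size = i} {s : Shape | s.size = j}).Finite := by
      intro c
      refine Set.Finite.biUnion (Finset.finite_toSet _) fun i hi => ?_
      refine Set.Finite.biUnion (Finset.finite_toSet _) fun j hj => ?_
      exact (ih i (by simpa using hi)).image2 _ (ih j (by simpa using hj))
    refine ((Set.finite_singleton leaf).union ((hfin .and).union (hfin .or))).subset ?_
    rintro (_ | ⟨c, l, r⟩) hs
    · simp
    · right
      have hl := l.size_pos
      have hr := r.size_pos
      simp only [Set.mem_ofPred_eq, size] at hs
      cases c
      · left
        simp only [Set.mem_iUnion, Finset.mem_range]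
        exact ⟨l.size, by omega, r.size, by omega, l, rfl, r, rfl, rfl⟩
      · right
        simp only [Set.mem_iUnion, Finset.mem_range]
        exact ⟨l.size, by omega, r.size, by omega, l, rfl, r, rfl, rfl⟩

end Shape

/-- The tree-structures with `n` leaves. -/
noncomputable def shapes (n : ℕ) : Finset Shape := (Shape.finite_setOf_size_eq n).toFinset

@[simp] theorem mem_shapes {n : ℕ} {s : Shape} : s ∈ shapes n ↔ s.size = n := by
  simp [shapes]

open Finset in
theorem sum_shapes (F : Shape → ℝ) (n : ℕ) :
    ∑ s ∈ shapes n, F s = (if n = 1 then F .leaf else 0) +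
      ∑ p ∈ antidiagonal n, ∑ l ∈ shapes p.1, ∑ r ∈ shapes p.2,
        (F (.node .and l r) + F (.node .or l r)) := by
  classical
  let T : Conn → Finset Shape := fun c => (antidiagonal n).biUnion fun p =>
    (shapes p.1 ×ˢ shapes p.2).image fun q => Shape.node c q.1 q.2
  have memT : ∀ c s, s ∈ T c ↔ ∃ l r, s = Shape.node c l r ∧ s.size = n := by
    intro c s
    simp only [T, mem_biUnion, HasAntidiagonal.mem_antidiagonal, mem_image,
      mem_product, mem_shapes, Prod.exists]
    constructor
    · rintro ⟨i, j, hij, l, r, ⟨rfl, rfl⟩, rfl⟩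
      exact ⟨l, r, rfl, hij⟩
    · rintro ⟨l, r, rfl, h⟩
      exact ⟨_, _, h, l, r, ⟨rfl, rfl⟩, rfl⟩
  have sumT : ∀ c, ∑ s ∈ T c, F s =
      ∑ p ∈ antidiagonal n, ∑ l ∈ shapes p.1, ∑ r ∈ shapes p.2, F (.node c l r) := by
    intro c
    rw [sum_biUnion]
    · refine sum_congr rfl fun p _ => ?_
      rw [sum_image, sum_product]
      rintro ⟨l, r⟩ _ ⟨l', r'⟩ _ h
      simpa using h
    · intro p _ q _ hpq
      rw [Function.onFun, disjoint_left]
      rintro s hs hs'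
      simp only [mem_image, mem_product, mem_shapes, Prod.exists] at hs hs'
      obtain ⟨l, r, ⟨h1, h2⟩, rfl⟩ := hs
      obtain ⟨l', r', ⟨h3, h4⟩, h⟩ := hs'
      simp only [Shape.node.injEq, true_and] at h
      obtain ⟨rfl, rfl⟩ := h
      exact hpq (Prod.ext (h1.symm.trans h3) (h2.symm.trans h4))
  have hsplit : shapes n = (if n = 1 then {Shape.leaf} else ∅) ∪ (T .and ∪ T .or) := by
    ext s
    rcases s with _ | ⟨c, l, r⟩
    · simp only [mem_shapes, mem_union, memT]
      split_ifs with h <;> simp [Shape.size, h, eq_comm]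
    · simp only [mem_shapes, mem_union, memT]
      split_ifs with h <;> cases c <;> simp
  rw [hsplit, sum_union, sum_union, sumT, sumT]
  · simp only [sum_add_distrib]
    congr 1
    split_ifs <;> simp
  · rw [disjoint_left]
    intro s hs hs'
    rw [memT] at hs hs'
    obtain ⟨l, r, rfl, _⟩ := hs
    obtain ⟨l', r', h, _⟩ := hs'
    simp at h
  · rw [disjoint_left]
    intro s hs hs'
    rw [mem_union, memT, memT] at hs'
    split_ifs at hs
    · rw [mem_singleton] at hs
      subst hs
      simp at hs'
    · simp at hs

section GeneratingFunctions

open PowerSeries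

/-- The generating function of tree-structures by size, weighted by `F`. -/
noncomputable def weightGF (F : Shape → ℝ) : ℝ⟦X⟧ := PowerSeries.mk fun n => ∑ s ∈ shapes n, F s

@[simp] theorem coeff_weightGF (F : Shape → ℝ) (n : ℕ) :
    coeff n (weightGF F) = ∑ s ∈ shapes n, F s := by
  simp [weightGF]

theorem weightGF_eq {ι : Type*} (I : Finset ι) (F : Shape → ℝ) (f g : ι → Shape → ℝ)
    (h : ∀ l r, F (.node .and l r) + F (.node .or l r) = ∑ k ∈ I, f k l * g k r) :
    weightGF F = F .leaf • (X : ℝ⟦X⟧) + ∑ k ∈ I, weightGF (f k) * weightGF (g k) := by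
  ext n
  simp only [coeff_weightGF, map_add, map_sum, coeff_mul, sum_shapes F n, h, coeff_smul, coeff_X]
  congr 1
  · simp
  · rw [Finset.sum_comm]
    refine Finset.sum_congr rfl fun p _ => ?_
    simp only [Finset.sum_mul_sum]
    rw [Finset.sum_congr rfl fun l _ => Finset.sum_comm, Finset.sum_comm]

/-- The generating function of tree-structures by size. -/
noncomputable def shapeGF : ℝ⟦X⟧ := weightGF fun _ => 1

theorem coeff_shapeGF (n : ℕ) : coeff n shapeGF = ((shapes n).card : ℝ) := by
  simp [shapeGF]

theorem shapeGF_eq : shapeGF = X + 2 * shapeGF ^ 2 := by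
  have := weightGF_eq (Finset.univ : Finset Bool) (fun _ => 1) (fun _ _ => 1) (fun _ _ => 1)
    (by intros; norm_num)
  simp only [one_smul, Fintype.univ_bool, Finset.sum_const] at this
  rw [← shapeGF] at this
  conv_lhs => rw [this]
  simp [two_mul, two_smul, sq]

theorem coeff_shapeGF_succ (n : ℕ) : coeff (n + 1) shapeGF = 2 ^ n * (catalan n : ℝ) := by
  set c : ℝ⟦X⟧ := PowerSeries.map (Nat.castRingHom ℝ) catalanSeries with hc
  set G : ℝ⟦X⟧ := X * rescale 2 c with hG
  have hceq : c ^ 2 * X + 1 = c := by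
    have := congrArg (PowerSeries.map (Nat.castRingHom ℝ)) catalanSeries_sq_mul_X_add_one
    simpa [hc] using this
  have hr : (rescale 2 c) ^ 2 * (2 * X) + 1 = rescale 2 c := by
    have := congrArg (rescale (2 : ℝ)) hceq
    simpa [rescale_X, show (C (2 : ℝ) : ℝ⟦X⟧) = 2 from map_ofNat C 2] using this
  have hGeq : G = X + 2 * G ^ 2 := by
    rw [hG]; linear_combination (-X) * hr
  have hzero : constantCoeff shapeGF = 0 := by
    rw [← coeff_zero_eq_constantCoeff_apply, coeff_shapeGF, Nat.cast_eq_zero, Finset.card_eq_zero,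
      Finset.eq_empty_iff_forall_notMem]
    intro s hs
    have := s.size_pos
    simp at hs
    omega
  have hprod : (shapeGF - G) * (1 - 2 * (shapeGF + G)) = 0 := by
    linear_combination shapeGF_eq - hGeq
  have hne : (1 - 2 * (shapeGF + G)) ≠ 0 := by
    intro h
    have := congrArg constantCoeff h
    simp [hzero, hG] at this
  have : shapeGF = G := by
    rcases mul_eq_zero.mp hprod with h | h
    · exact sub_eq_zero.mp h
    · exact absurd h hne
  rw [this, hG, coeff_succ_X_mul, coeff_rescale]
  simp [hc]

theorem shapeGF_recurrence (n : ℕ) :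
    ((n : ℝ) + 2) * coeff (n + 2) shapeGF = 4 * (2 * n + 1) * coeff (n + 1) shapeGF := by
  have h1 := succ_mul_catalan_eq_centralBinom (n + 1)
  have h2 := Nat.succ_mul_centralBinom_succ n
  rw [← h1, ← succ_mul_catalan_eq_centralBinom n] at h2
  have h3 : ((n : ℝ) + 1) * ((n + 2) * catalan (n + 1)) =
      (n + 1) * (2 * (2 * n + 1) * catalan n) := by
    have := congrArg (Nat.cast : ℕ → ℝ) h2
    push_cast at this
    linear_combination this
  have h4 := mul_left_cancel₀ (by positivity) h3
  rw [coeff_shapeGF_succ n, coeff_shapeGF_succ (n + 1), pow_succ]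
  linear_combination (2 : ℝ) ^ n * 2 * h4

theorem coeff_zero_shapeGF : coeff 0 shapeGF = 0 := by
  have h : (shapes 0).card = 0 := by
    rw [Finset.card_eq_zero, Finset.eq_empty_iff_forall_notMem]
    intro s hs
    have := s.size_pos
    simp at hs
    omega
  rw [coeff_shapeGF, h, Nat.cast_zero]

theorem constantCoeff_shapeGF : constantCoeff shapeGF = 0 := by
  rw [← coeff_zero_eq_constantCoeff_apply, coeff_zero_shapeGF]

theorem coeff_one_shapeGF : coeff 1 shapeGF = 1 := by
  rw [coeff_shapeGF_succ 0]; simp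

theorem coeff_shapeGF_nonneg (n : ℕ) : 0 ≤ coeff n shapeGF := by
  rw [coeff_shapeGF]; positivity

theorem coeff_shapeGF_pos {n : ℕ} (hn : 1 ≤ n) : 0 < coeff n shapeGF := by
  induction n, hn using Nat.le_induction with
  | base => simp [coeff_one_shapeGF]
  | succ m hm ih =>
    obtain ⟨m, rfl⟩ := Nat.exists_eq_add_of_le' hm
    have h := shapeGF_recurrence m
    have : 0 < ((m : ℝ) + 2) * coeff (m + 2) shapeGF := by rw [h]; positivity
    exact pos_of_mul_pos_right this (by positivity)

theorem coeff_succ_shapeGF_le {n : ℕ} (hn : 1 ≤ n) :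
    coeff (n + 1) shapeGF ≤ 8 * coeff n shapeGF := by
  obtain ⟨m, rfl⟩ := Nat.exists_eq_add_of_le' hn
  have h := shapeGF_recurrence m
  have h0 := coeff_shapeGF_nonneg (m + 1)
  have : ((m : ℝ) + 2) * coeff (m + 2) shapeGF ≤ (m + 2) * (8 * coeff (m + 1) shapeGF) := by
    rw [h]; nlinarith
  exact le_of_mul_le_mul_left this (by positivity)

theorem tendsto_coeff_shapeGF_ratio :
    Tendsto (fun n => coeff (n + 1) shapeGF / coeff n shapeGF) atTop (nhds 8) := by
  rw [← tendsto_add_atTop_iff_nat 1]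
  have h : ∀ n : ℕ, coeff (n + 1 + 1) shapeGF / coeff (n + 1) shapeGF =
      8 - 12 / ((n : ℝ) + 2) := by
    intro n
    have h0 := coeff_shapeGF_pos (n := n + 1) (by omega)
    have h1 := shapeGF_recurrence n
    field_simp
    linear_combination h1
  simp only [h]
  have : Tendsto (fun n : ℕ => (12 : ℝ) / ((n : ℝ) + 2)) atTop (nhds 0) :=
    tendsto_const_nhds.div_atTop
      (tendsto_atTop_add_const_right _ _ tendsto_natCast_atTop_atTop)
  simpa using this.const_sub 8

theorem sum_coeff_shapeGF_div (n : ℕ) :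
    ∑ i ∈ Finset.range (n + 1), coeff i shapeGF / 8 ^ i =
      2 * (1 / 8 - (n + 1) * (coeff (n + 1) shapeGF / 8 ^ (n + 1))) := by
  induction n with
  | zero => simp [coeff_zero_shapeGF, coeff_one_shapeGF]
  | succ n ih =>
    rw [Finset.sum_range_succ, ih]
    have h := shapeGF_recurrence n
    push_cast
    linear_combination (1 / 8 ^ (n + 1)) / 4 * h

theorem sum_coeff_shapeGF_div_le (n : ℕ) :
    ∑ i ∈ Finset.range n, coeff i shapeGF / 8 ^ i ≤ 1 / 4 := by
  cases n with
  | zero => simp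
  | succ n =>
    rw [sum_coeff_shapeGF_div]
    have := coeff_shapeGF_nonneg (n + 1)
    have : 0 ≤ ((n : ℝ) + 1) * (coeff (n + 1) shapeGF / 8 ^ (n + 1)) := by positivity
    linarith

theorem coeff_shapeGF_le_pow (n : ℕ) : coeff n shapeGF ≤ 8 ^ n / 4 := by
  have h := sum_coeff_shapeGF_div_le (n + 1)
  have h1 := Finset.single_le_sum (f := fun i => coeff i shapeGF / (8 : ℝ) ^ i)
    (fun i _ => div_nonneg (coeff_shapeGF_nonneg i) (by positivity))
    (Finset.self_mem_range_succ n)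
  have h2 := h1.trans h
  rw [div_le_iff₀ (by positivity)] at h2
  linarith

/-- Solution `W` of `W = A + 3 A W`, where `A` is the generating function of tree-structures. -/
noncomputable def resolventGF : ℝ⟦X⟧ := shapeGF * (1 - 3 * shapeGF)⁻¹

theorem resolventGF_mul : (1 - 3 * shapeGF) * resolventGF = shapeGF := by
  have : constantCoeff (1 - 3 * shapeGF) ≠ 0 := by
    simp [constantCoeff_shapeGF]
  rw [resolventGF, mul_left_comm, PowerSeries.mul_inv_cancel _ this, mul_one]

theorem coeff_three_mul (F G : ℝ⟦X⟧) (n : ℕ) :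
    coeff n (3 * F * G) =
      3 * ∑ p ∈ Finset.HasAntidiagonal.antidiagonal n, coeff p.1 F * coeff p.2 G := by
  rw [mul_assoc, show (3 : ℝ⟦X⟧) = C 3 from (map_ofNat C 3).symm, coeff_C_mul, coeff_mul]

theorem coeff_resolventGF (n : ℕ) : coeff n resolventGF = coeff n shapeGF +
    3 * ∑ p ∈ Finset.HasAntidiagonal.antidiagonal n, coeff p.1 shapeGF * coeff p.2 resolventGF := by
  rw [← coeff_three_mul, ← map_add]
  congr 1
  linear_combination resolventGF_mul

theorem coeff_resolventGF_succ {n : ℕ} (hn : 1 ≤ n) :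
    coeff (n + 1) resolventGF = 9 * coeff n resolventGF - 2 * coeff (n + 1) shapeGF := by
  have h : resolventGF = 3 * X - 2 * shapeGF + 9 * (X * resolventGF) := by
    linear_combination (1 - 6 * shapeGF) * resolventGF_mul
      + (9 * resolventGF + 3) * shapeGF_eq
  have h3 : ∀ (r : ℝ) (F : ℝ⟦X⟧) m, coeff m (C r * F) = r * coeff m F := fun r F m =>
    coeff_C_mul m F r
  have := congrArg (coeff (n + 1)) h
  rw [show (3 : ℝ⟦X⟧) = C 3 from (map_ofNat C 3).symm,
    show (2 : ℝ⟦X⟧) = C 2 from (map_ofNat C 2).symm,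
    show (9 : ℝ⟦X⟧) = C 9 from (map_ofNat C 9).symm, map_add, map_sub, h3, h3, h3, coeff_X,
    if_neg (by omega), coeff_succ_X_mul] at this
  rw [this]; ring

theorem sum_antidiagonal_shapeGF_le {f g : ℕ → ℝ} {n : ℕ} (h : ∀ m < n, f m ≤ g m) :
    ∑ p ∈ Finset.HasAntidiagonal.antidiagonal n, coeff p.1 shapeGF * f p.2 ≤
      ∑ p ∈ Finset.HasAntidiagonal.antidiagonal n, coeff p.1 shapeGF * g p.2 := by
  refine Finset.sum_le_sum fun p hp => ?_
  rw [Finset.HasAntidiagonal.mem_antidiagonal] at hp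
  rcases Nat.eq_zero_or_pos p.1 with h0 | h0
  · simp [h0, coeff_zero_shapeGF]
  · exact mul_le_mul_of_nonneg_left (h _ (by omega)) (coeff_shapeGF_nonneg _)

theorem coeff_resolventGF_le_pow (n : ℕ) : coeff n resolventGF ≤ 8 ^ n := by
  induction n using Nat.strong_induction_on with
  | _ n ih =>
    rw [coeff_resolventGF]
    have h1 := sum_antidiagonal_shapeGF_le ih
    have h2 : ∑ p ∈ Finset.HasAntidiagonal.antidiagonal n, coeff p.1 shapeGF * (8 : ℝ) ^ p.2 =
        8 ^ n * ∑ i ∈ Finset.range (n + 1), coeff i shapeGF / 8 ^ i := by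
      rw [Finset.Nat.sum_antidiagonal_eq_sum_range_succ fun i j => coeff i shapeGF * (8 : ℝ) ^ j,
        Finset.mul_sum]
      refine Finset.sum_congr rfl fun i hi => ?_
      have : i ≤ n := by simpa [Nat.lt_succ_iff] using hi
      rw [pow_sub₀ _ (by norm_num) this]
      field_simp
    have h3 := mul_le_mul_of_nonneg_left (sum_coeff_shapeGF_div_le (n + 1))
      (by positivity : (0 : ℝ) ≤ 8 ^ n)
    have h4 := coeff_shapeGF_le_pow n
    linarith

theorem coeff_resolventGF_le (n : ℕ) : coeff n resolventGF ≤ 16 * coeff n shapeGF := by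
  rcases Nat.eq_zero_or_pos n with rfl | hn
  · rw [coeff_resolventGF]
    simp [coeff_zero_shapeGF]
  by_contra! hlt
  set δ := coeff n resolventGF - 16 * coeff n shapeGF with hδ
  have hδ0 : 0 < δ := by linarith
  have key : ∀ m, 9 ^ m * δ ≤ coeff (n + m) resolventGF - 16 * coeff (n + m) shapeGF := by
    intro m
    induction m with
    | zero => simp [hδ]
    | succ m ih =>
      have h1 := coeff_resolventGF_succ (n := n + m) (by omega)
      have h2 := coeff_succ_shapeGF_le (n := n + m) (by omega)
      rw [← add_assoc, h1, pow_succ]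
      linarith
  obtain ⟨m, hm⟩ := pow_unbounded_of_one_lt (8 ^ n / δ) (by norm_num : (1 : ℝ) < 9 / 8)
  have h1 := key m
  have h2 := coeff_resolventGF_le_pow (n + m)
  have h3 := coeff_shapeGF_nonneg (n + m)
  rw [div_lt_iff₀ hδ0, div_pow, div_mul_eq_mul_div, lt_div_iff₀ (by positivity), ← pow_add] at hm
  linarith

/-- A power series with nonnegative coefficients, dominated by a multiple of the generating
function of tree-structures. -/
def ShapeBounded (F : ℝ⟦X⟧) : Prop :=
  (∀ n, 0 ≤ coeff n F) ∧ ∃ c : ℝ, 0 ≤ c ∧ ∀ n, coeff n F ≤ c * coeff n shapeGF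

namespace ShapeBounded

theorem shapeGF : ShapeBounded shapeGF :=
  ⟨coeff_shapeGF_nonneg, 1, zero_le_one, fun n => by rw [one_mul]⟩

theorem X : ShapeBounded (X : ℝ⟦X⟧) := by
  refine ⟨fun n => ?_, 1, zero_le_one, fun n => ?_⟩
  · rw [coeff_X]; split_ifs <;> norm_num
  · rw [coeff_X]
    split_ifs with h
    · simp [h, coeff_one_shapeGF]
    · simpa using coeff_shapeGF_nonneg n

theorem add {F G : ℝ⟦X⟧} (hF : ShapeBounded F) (hG : ShapeBounded G) : ShapeBounded (F + G) := by
  obtain ⟨hF0, c, hc, hF⟩ := hF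
  obtain ⟨hG0, d, hd, hG⟩ := hG
  refine ⟨fun n => by rw [map_add]; exact add_nonneg (hF0 n) (hG0 n), c + d, by positivity,
    fun n => ?_⟩
  rw [map_add, add_mul]
  exact add_le_add (hF n) (hG n)

theorem smul {F : ℝ⟦X⟧} {r : ℝ} (hr : 0 ≤ r) (hF : ShapeBounded F) : ShapeBounded (r • F) := by
  obtain ⟨hF0, c, hc, hF⟩ := hF
  refine ⟨fun n => ?_, r * c, by positivity, fun n => ?_⟩
  · rw [coeff_smul]; exact mul_nonneg hr (hF0 n)
  · rw [coeff_smul, smul_eq_mul, mul_assoc]; exact mul_le_mul_of_nonneg_left (hF n) hr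

theorem mul {F G : ℝ⟦X⟧} (hF : ShapeBounded F) (hG : ShapeBounded G) : ShapeBounded (F * G) := by
  obtain ⟨hF0, c, hc, hF⟩ := hF
  obtain ⟨hG0, d, hd, hG⟩ := hG
  refine ⟨fun n => ?_, c * d, by positivity, fun n => ?_⟩
  · rw [coeff_mul]; exact Finset.sum_nonneg fun p _ => mul_nonneg (hF0 _) (hG0 _)
  · have h1 : coeff n (F * G) ≤ c * d * coeff n (CatalanSat.shapeGF ^ 2) := by
      rw [coeff_mul, sq, coeff_mul, Finset.mul_sum]
      refine Finset.sum_le_sum fun p _ => ?_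
      calc coeff p.1 F * coeff p.2 G
          ≤ (c * coeff p.1 CatalanSat.shapeGF) * (d * coeff p.2 CatalanSat.shapeGF) :=
            mul_le_mul (hF _) (hG _) (hG0 _) (mul_nonneg hc (coeff_shapeGF_nonneg _))
        _ = _ := by ring
    have h2 : coeff n (CatalanSat.shapeGF ^ 2) ≤ coeff n CatalanSat.shapeGF := by
      have h3 := congrArg (coeff n) shapeGF_eq
      rw [map_add, two_mul, map_add] at h3
      have h4 := X.1 n
      have h5 : 0 ≤ coeff n (CatalanSat.shapeGF ^ 2) := by
        rw [sq, coeff_mul]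
        exact Finset.sum_nonneg fun p _ =>
          mul_nonneg (coeff_shapeGF_nonneg _) (coeff_shapeGF_nonneg _)
      linarith
    exact h1.trans (mul_le_mul_of_nonneg_left h2 (by positivity))

theorem sum {ι : Type*} (I : Finset ι) {F : ι → ℝ⟦X⟧} (h : ∀ i ∈ I, ShapeBounded (F i)) :
    ShapeBounded (∑ i ∈ I, F i) := by
  classical
  induction I using Finset.induction_on with
  | empty => exact ⟨by simp, 0, le_rfl, by simp⟩
  | insert i I hi ih =>
    rw [Finset.sum_insert hi]
    exact (h i (Finset.mem_insert_self i I)).add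
      (ih fun j hj => h j (Finset.mem_insert_of_mem hj))

/-- A solution of `F ≤ 3 A F + H` with `H` bounded is bounded. -/
theorem of_le {F H : ℝ⟦X⟧} (hF : ∀ n, 0 ≤ coeff n F) (hH : ShapeBounded H)
    (h : ∀ n, coeff n F ≤ coeff n (3 * CatalanSat.shapeGF * F + H)) : ShapeBounded F := by
  obtain ⟨_, c, hc, hH⟩ := hH
  have key : ∀ n, coeff n F ≤ c * coeff n resolventGF := by
    intro n
    induction n using Nat.strong_induction_on with
    | _ n ih =>
      have h1 := sum_antidiagonal_shapeGF_le ih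
      have h2 := h n
      rw [map_add, coeff_three_mul] at h2
      have h3 : ∑ p ∈ Finset.HasAntidiagonal.antidiagonal n,
          coeff p.1 CatalanSat.shapeGF * (c * coeff p.2 resolventGF) =
          c * ∑ p ∈ Finset.HasAntidiagonal.antidiagonal n,
            coeff p.1 CatalanSat.shapeGF * coeff p.2 resolventGF := by
        rw [Finset.mul_sum]
        exact Finset.sum_congr rfl fun p _ => by ring
      rw [coeff_resolventGF n]
      have h4 := hH n
      linarith
  refine ⟨hF, c * 16, by positivity, fun n => (key n).trans ?_⟩
  rw [mul_assoc]
  exact mul_le_mul_of_nonneg_left (coeff_resolventGF_le n) hc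

end ShapeBounded

theorem coeff_weightGF_nonneg {F : Shape → ℝ} (hF : ∀ s, 0 ≤ F s) (n : ℕ) :
    0 ≤ coeff n (weightGF F) := by
  rw [coeff_weightGF]; exact Finset.sum_nonneg fun s _ => hF s

theorem weightGF_mul_const (F : Shape → ℝ) (r : ℝ) :
    weightGF (fun s => F s * r) = r • weightGF F := by
  ext n
  simp [Finset.sum_mul, mul_comm r]

theorem weightGF_binomial_middle_bounded {c : Shape → ℝ} (r : ℕ)
    (h : ∀ k ≤ r, ShapeBounded (weightGF fun s => c s ^ k)) :
    ShapeBounded (∑ k ∈ Finset.range r, weightGF (fun s => c s ^ (k + 1)) *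
      weightGF (fun s => c s ^ (r - k) * ((r + 1).choose (k + 1) : ℝ))) := by
  refine ShapeBounded.sum _ fun k hk => ?_
  rw [Finset.mem_range] at hk
  refine (h _ (by omega)).mul ?_
  rw [weightGF_mul_const]
  exact ShapeBounded.smul (by positivity) (h _ (by omega))

theorem weightGF_binomial_sum (c : Shape → ℝ) (r : ℕ) :
    ∑ k ∈ Finset.range (r + 2), weightGF (fun s => c s ^ k) *
      weightGF (fun s => c s ^ (r + 1 - k) * ((r + 1).choose k : ℝ)) =
    2 * shapeGF * weightGF (fun s => c s ^ (r + 1)) +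
    ∑ k ∈ Finset.range r, weightGF (fun s => c s ^ (k + 1)) *
      weightGF (fun s => c s ^ (r - k) * ((r + 1).choose (k + 1) : ℝ)) := by
  rw [Finset.sum_range_succ, Finset.sum_range_succ']
  simp only [pow_zero, Nat.sub_zero, Nat.choose_zero_right, Nat.cast_one, mul_one, Nat.sub_self,
    Nat.choose_self, Nat.add_sub_add_right]
  rw [← shapeGF]
  ring

/-- Moments of a statistic that is additive at `∨` and inherited from the left at `∧`. -/
theorem weightGF_pow_bounded_of_left {c : Shape → ℝ} (hc0 : ∀ s, 0 ≤ c s)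
    (hand : ∀ l r, c (.node .and l r) = c l) (hor : ∀ l r, c (.node .or l r) = c l + c r)
    (r : ℕ) : ShapeBounded (weightGF fun s => c s ^ r) := by
  induction r using Nat.strong_induction_on with
  | _ r ih =>
    rcases r with _ | r
    · simp only [pow_zero]
      exact ShapeBounded.shapeGF
    have hrec := weightGF_eq ((Finset.range (r + 2)).disjSum (Finset.univ : Finset Unit))
      (fun s => c s ^ (r + 1))
      (Sum.elim (fun k s => c s ^ k) (fun _ s => c s ^ (r + 1)))
      (Sum.elim (fun k s => c s ^ (r + 1 - k) * ((r + 1).choose k : ℝ)) (fun _ _ => 1)) (by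
        intro a b
        rw [hand, hor, Finset.sum_disjSum, add_pow]
        simp only [Sum.elim_inl, Sum.elim_inr, Finset.univ_unique, Finset.sum_singleton, mul_assoc]
        ring)
    rw [Finset.sum_disjSum] at hrec
    simp only [Sum.elim_inl, Sum.elim_inr, Finset.univ_unique, Finset.sum_singleton] at hrec
    rw [weightGF_binomial_sum, ← shapeGF] at hrec
    refine ShapeBounded.of_le (coeff_weightGF_nonneg fun s => pow_nonneg (hc0 s) _)
      ((ShapeBounded.X.smul (pow_nonneg (hc0 .leaf) (r + 1))).add
        (weightGF_binomial_middle_bounded r fun k hk => ih k (by omega)))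
      fun n => le_of_eq (congrArg (coeff n) ?_)
    linear_combination hrec

/-- Moments of a statistic that is additive at `∨`, and at `∧` is the sum of the values of another
statistic with bounded moments. -/
theorem weightGF_pow_bounded_of_add {c d : Shape → ℝ} (hd0 : ∀ s, 0 ≤ d s)
    (hand : ∀ l r, d (.node .and l r) = c l + c r) (hor : ∀ l r, d (.node .or l r) = d l + d r)
    (hc : ∀ r, ShapeBounded (weightGF fun s => c s ^ r)) (r : ℕ) :
    ShapeBounded (weightGF fun s => d s ^ r) := by
  induction r using Nat.strong_induction_on with
  | _ r ih =>
    rcases r with _ | r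
    · simp only [pow_zero]
      exact ShapeBounded.shapeGF
    have hrec := weightGF_eq ((Finset.range (r + 2)).disjSum (Finset.range (r + 2)))
      (fun s => d s ^ (r + 1))
      (Sum.elim (fun k s => d s ^ k) (fun k s => c s ^ k))
      (Sum.elim (fun k s => d s ^ (r + 1 - k) * ((r + 1).choose k : ℝ))
        (fun k s => c s ^ (r + 1 - k) * ((r + 1).choose k : ℝ))) (by
        intro a b
        rw [hand, hor, Finset.sum_disjSum, add_pow, add_pow]
        simp only [Sum.elim_inl, Sum.elim_inr, mul_assoc]
        ring)
    rw [Finset.sum_disjSum] at hrec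
    simp only [Sum.elim_inl, Sum.elim_inr] at hrec
    rw [weightGF_binomial_sum, weightGF_binomial_sum] at hrec
    have h2 := (ShapeBounded.shapeGF.mul (hc (r + 1))).smul (by norm_num : (0 : ℝ) ≤ 2)
    have hF := coeff_weightGF_nonneg fun s => pow_nonneg (hd0 s) (r + 1)
    refine ShapeBounded.of_le hF
      (((ShapeBounded.X.smul (pow_nonneg (hd0 .leaf) (r + 1))).add
        (weightGF_binomial_middle_bounded r fun k hk => ih k (by omega))).add
          (h2.add (weightGF_binomial_middle_bounded r fun k _ => hc k)))
      fun n => ?_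
    have h3 : 0 ≤ coeff n (shapeGF * weightGF fun s => d s ^ (r + 1)) := by
      rw [coeff_mul]
      exact Finset.sum_nonneg fun p _ => mul_nonneg (coeff_shapeGF_nonneg _) (hF _)
    rw [← sub_nonneg, ← map_sub]
    convert h3 using 2
    rw [show (2 : ℝ) • (shapeGF * weightGF fun s => c s ^ (r + 1)) =
      2 * (shapeGF * weightGF fun s => c s ^ (r + 1)) by rw [two_smul, two_mul]]
    linear_combination -hrec

theorem weightGF_eq_shapeGF {c : Shape → ℝ} (hleaf : c .leaf = 1)
    (hand : ∀ l r, c (.node .and l r) = 0) (hor : ∀ l r, c (.node .or l r) = c l + c r) :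
    weightGF c = shapeGF := by
  have hrec := weightGF_eq (Finset.univ : Finset Bool) c (fun b s => if b then 1 else c s)
    (fun b s => if b then c s else 1) (by
      intro l r; rw [hand, hor]; simp [add_comm])
  simp only [hleaf, one_smul, Fintype.univ_bool, Finset.mem_singleton, Bool.true_eq_false,
    not_false_eq_true, Finset.sum_insert, Finset.sum_singleton, if_true, Bool.false_eq_true,
    if_false] at hrec
  rw [← shapeGF] at hrec
  have hprod : (weightGF c - shapeGF) * (1 - 2 * shapeGF) = 0 := by
    linear_combination hrec - shapeGF_eq
  have hne : (1 - 2 * shapeGF) ≠ 0 := by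
    intro h
    have := congrArg constantCoeff h
    simp [constantCoeff_shapeGF] at this
  rcases mul_eq_zero.mp hprod with h | h
  · exact sub_eq_zero.mp h
  · exact absurd h hne

/-- The total number of pairs, for an additive statistic vanishing at `∧`. -/
theorem sum_shapes_pairs {c : Shape → ℝ} (hleaf : c .leaf = 1)
    (hand : ∀ l r, c (.node .and l r) = 0) (hor : ∀ l r, c (.node .or l r) = c l + c r)
    {n : ℕ} (hn : 1 ≤ n) :
    ∑ s ∈ shapes n, c s * (c s - 1) / 2 =
      coeff (n + 1) shapeGF / 4 - coeff n shapeGF / 2 := by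
  have hc := weightGF_eq_shapeGF hleaf hand hor
  have hrec := weightGF_eq (Finset.univ : Finset (Fin 3)) (fun s => c s * (c s - 1) / 2)
    ![fun _ => 1, fun s => c s * (c s - 1) / 2, c]
    ![fun s => c s * (c s - 1) / 2, fun _ => 1, c] (by
      intro l r
      rw [hand, hor]
      simp [Fin.sum_univ_three]
      ring)
  simp only [Fin.sum_univ_three, Matrix.cons_val, hleaf, hc] at hrec
  rw [← shapeGF] at hrec
  set P := weightGF fun s => c s * (c s - 1) / 2 with hP
  simp only [sub_self, mul_zero, zero_div, zero_smul, zero_add] at hrec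
  have hX : (4 : ℝ) • (X * P) = shapeGF - X - (2 : ℝ) • (X * shapeGF) := by
    rw [smul_eq_C_mul, smul_eq_C_mul, map_ofNat, map_ofNat]
    linear_combination 4 * shapeGF * hrec - (4 * P + 1 + 2 * shapeGF) * shapeGF_eq
  have := congrArg (coeff (n + 1)) hX
  rw [map_sub, map_sub, coeff_smul, coeff_smul, coeff_succ_X_mul, coeff_succ_X_mul, coeff_X,
    if_neg (by omega), hP, coeff_weightGF, smul_eq_mul, smul_eq_mul] at this
  linarith

end GeneratingFunctions

theorem card_union_map_add {A B : Finset ℕ} {m : ℕ} (hA : ∀ i ∈ A, i < m) :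
    (A ∪ B.map (addLeftEmbedding m)).card = A.card + B.card := by
  rw [Finset.card_union_of_disjoint, Finset.card_map]
  rw [Finset.disjoint_left]
  intro i hi hi'
  have := hA i hi
  simp only [Finset.mem_map, addLeftEmbedding_apply] at hi'
  obtain ⟨j, _, hj⟩ := hi'
  omega

namespace Shape

/-- The value at the root when the `i`-th leaf has value `g i`. -/
def eval : Shape → (ℕ → Bool) → Bool
  | .leaf, g => g 0
  | .node .and l r, g => l.eval g && r.eval fun i => g (l.size + i)
  | .node .or l r, g => l.eval g || r.eval fun i => g (l.size + i)

/-- The leaves linked to the root by `∨`-labelled nodes only. -/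
def orLeaves : Shape → Finset ℕ
  | .leaf => {0}
  | .node .and _ _ => ∅
  | .node .or l r => l.orLeaves ∪ r.orLeaves.map (addLeftEmbedding l.size)

/-- The leaves reached from the root by going to both children at `∨` and to the left at `∧`. -/
def leftPattern : Shape → Finset ℕ
  | .leaf => {0}
  | .node .and l _ => l.leftPattern
  | .node .or l r => l.leftPattern ∪ r.leftPattern.map (addLeftEmbedding l.size)

/-- The union of all patterns that go to both children at `∨`, to either child at the first `∧` on
each branch, and to the left at later ones. -/
def fullPattern : Shape → Finset ℕ
  | .leaf => {0}
  | .node .and l r => l.leftPattern ∪ r.leftPattern.map (addLeftEmbedding l.size)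
  | .node .or l r => l.fullPattern ∪ r.fullPattern.map (addLeftEmbedding l.size)

theorem lt_size_of_mem_union {l r : Shape} {A B : Finset ℕ} (hA : ∀ i ∈ A, i < l.size)
    (hB : ∀ i ∈ B, i < r.size) (c : Conn) :
    ∀ i ∈ A ∪ B.map (addLeftEmbedding l.size), i < (node c l r).size := by
  intro i hi
  simp only [Finset.mem_union, Finset.mem_map, addLeftEmbedding_apply] at hi
  simp only [size]
  rcases hi with hi | ⟨j, hj, rfl⟩
  · have := hA i hi
    omega
  · have := hB j hj
    omega

theorem lt_size_of_mem_orLeaves (s : Shape) : ∀ i ∈ s.orLeaves, i < s.size := by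
  induction s with
  | leaf => simp [orLeaves, size]
  | node c l r ihl ihr =>
    cases c
    · simp [orLeaves]
    · exact lt_size_of_mem_union ihl ihr _

theorem lt_size_of_mem_leftPattern (s : Shape) : ∀ i ∈ s.leftPattern, i < s.size := by
  induction s with
  | leaf => simp [leftPattern, size]
  | node c l r ihl ihr =>
    cases c
    · intro i hi
      have := ihl i hi
      simp only [size]
      omega
    · exact lt_size_of_mem_union ihl ihr _

theorem lt_size_of_mem_fullPattern (s : Shape) : ∀ i ∈ s.fullPattern, i < s.size := by
  induction s with
  | leaf => simp [fullPattern, size]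
  | node c l r ihl ihr =>
    cases c
    · exact lt_size_of_mem_union l.lt_size_of_mem_leftPattern r.lt_size_of_mem_leftPattern _
    · exact lt_size_of_mem_union ihl ihr _

theorem leftPattern_subset_fullPattern (s : Shape) : s.leftPattern ⊆ s.fullPattern := by
  induction s with
  | leaf => exact subset_rfl
  | node c l r ihl ihr =>
    cases c
    · exact Finset.subset_union_left
    · exact Finset.union_subset_union ihl (Finset.map_subset_map.mpr ihr)

theorem orLeaves_subset_fullPattern (s : Shape) : s.orLeaves ⊆ s.fullPattern := by
  induction s with
  | leaf => exact subset_rfl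
  | node c l r ihl ihr =>
    cases c
    · exact Finset.empty_subset _
    · exact Finset.union_subset_union ihl (Finset.map_subset_map.mpr ihr)

theorem card_orLeaves_or (l r : Shape) :
    (node .or l r).orLeaves.card = l.orLeaves.card + r.orLeaves.card :=
  card_union_map_add l.lt_size_of_mem_orLeaves

theorem card_leftPattern_or (l r : Shape) :
    (node .or l r).leftPattern.card = l.leftPattern.card + r.leftPattern.card :=
  card_union_map_add l.lt_size_of_mem_leftPattern

theorem card_fullPattern_and (l r : Shape) :
    (node .and l r).fullPattern.card = l.leftPattern.card + r.leftPattern.card :=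
  card_union_map_add l.lt_size_of_mem_leftPattern

theorem card_fullPattern_or (l r : Shape) :
    (node .or l r).fullPattern.card = l.fullPattern.card + r.fullPattern.card :=
  card_union_map_add l.lt_size_of_mem_fullPattern

theorem sum_card_fullPattern_pow_bounded (r : ℕ) :
    ∃ c : ℝ, 0 ≤ c ∧ ∀ n, ∑ s ∈ shapes n, (s.fullPattern.card : ℝ) ^ r ≤ c * (shapes n).card := by
  obtain ⟨_, c, hc, h⟩ := weightGF_pow_bounded_of_add
    (c := fun s => (s.leftPattern.card : ℝ)) (d := fun s => (s.fullPattern.card : ℝ))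
    (fun _ => Nat.cast_nonneg _) (fun l r => by simp [card_fullPattern_and])
    (fun l r => by simp [card_fullPattern_or])
    (weightGF_pow_bounded_of_left (fun _ => Nat.cast_nonneg _) (fun l r => rfl)
      (fun l r => by simp [card_leftPattern_or])) r
  exact ⟨c, hc, fun n => by simpa [coeff_shapeGF] using h n⟩

theorem sum_card_orLeaves_pairs {n : ℕ} (hn : 1 ≤ n) :
    ∑ s ∈ shapes n, (s.orLeaves.card : ℝ) * (s.orLeaves.card - 1) / 2 =
      ((shapes (n + 1)).card : ℝ) / 4 - (shapes n).card / 2 := by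
  have := sum_shapes_pairs (c := fun s => (s.orLeaves.card : ℝ)) (by simp [orLeaves])
    (fun l r => by simp [orLeaves]) (fun l r => by simp [card_orLeaves_or]) hn
  simpa [coeff_shapeGF] using this

theorem eval_eq_false_of_leftPattern (s : Shape) {g : ℕ → Bool}
    (h : ∀ i ∈ s.leftPattern, g i = false) : s.eval g = false := by
  induction s generalizing g with
  | leaf => exact h 0 (by simp [leftPattern])
  | node c l r ihl ihr =>
    cases c
    · simp [eval, ihl h]
    · simp only [eval, Bool.or_eq_false_iff]
      exact ⟨ihl fun i hi => h i (Finset.mem_union_left _ hi),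
        ihr fun i hi => h _ (Finset.mem_union_right _ (Finset.mem_map_of_mem _ hi))⟩

theorem eval_eq_true_of_orLeaves (s : Shape) {g : ℕ → Bool} {i : ℕ} (hi : i ∈ s.orLeaves)
    (h : g i = true) : s.eval g = true := by
  induction s generalizing g i with
  | leaf =>
    simp only [orLeaves, Finset.mem_singleton] at hi
    simpa [eval, hi] using h
  | node c l r ihl ihr =>
    cases c
    · simp [orLeaves] at hi
    · simp only [orLeaves, Finset.mem_union, Finset.mem_map, addLeftEmbedding_apply] at hi
      simp only [eval, Bool.or_eq_true]
      rcases hi with hi | ⟨j, hj, rfl⟩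
      · exact Or.inl (ihl hi h)
      · exact Or.inr (ihr hj h)

/-- Any leaf of the left pattern that is not linked to the root by `∨` only can be avoided by
another falsifying set of leaves. -/
theorem exists_falsifying_avoiding (s : Shape) {i : ℕ} (hi : i ∈ s.leftPattern)
    (hi' : i ∉ s.orLeaves) : ∃ P ⊆ s.fullPattern, i ∉ P ∧
      ∀ g : ℕ → Bool, (∀ j ∈ P, g j = false) → s.eval g = false := by
  induction s generalizing i with
  | leaf => exact absurd hi hi'
  | node c l r ihl ihr =>
    cases c
    · refine ⟨r.leftPattern.map (addLeftEmbedding l.size), Finset.subset_union_right, ?_, ?_⟩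
      · intro hmem
        have := l.lt_size_of_mem_leftPattern i hi
        simp only [Finset.mem_map, addLeftEmbedding_apply] at hmem
        obtain ⟨j, _, hj⟩ := hmem
        omega
      · intro g hg
        have : r.eval (fun j => g (l.size + j)) = false :=
          r.eval_eq_false_of_leftPattern fun j hj => hg _ (Finset.mem_map_of_mem _ hj)
        simp [eval, this]
    · simp only [leftPattern, orLeaves, Finset.mem_union, Finset.mem_map, addLeftEmbedding_apply,
        not_or] at hi hi'
      rcases hi with hi | ⟨j, hj, rfl⟩
      · obtain ⟨P, hP, hiP, hf⟩ := ihl hi hi'.1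
        refine ⟨P ∪ r.leftPattern.map (addLeftEmbedding l.size),
          Finset.union_subset_union hP
            (Finset.map_subset_map.mpr r.leftPattern_subset_fullPattern), ?_, ?_⟩
        · have := l.lt_size_of_mem_leftPattern i hi
          simp only [Finset.mem_union, hiP, Finset.mem_map, addLeftEmbedding_apply, false_or]
          rintro ⟨j, _, hj⟩
          omega
        · intro g hg
          simp only [eval, Bool.or_eq_false_iff]
          exact ⟨hf g fun j hj => hg j (Finset.mem_union_left _ hj),
            r.eval_eq_false_of_leftPattern fun j hj =>
              hg _ (Finset.mem_union_right _ (Finset.mem_map_of_mem _ hj))⟩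
      · obtain ⟨P, hP, hiP, hf⟩ := ihr hj fun hmem => hi'.2 ⟨j, hmem, rfl⟩
        refine ⟨l.leftPattern ∪ P.map (addLeftEmbedding l.size),
          Finset.union_subset_union l.leftPattern_subset_fullPattern
            (Finset.map_subset_map.mpr hP), ?_, ?_⟩
        · simp only [Finset.mem_union, Finset.mem_map, addLeftEmbedding_apply, not_or]
          refine ⟨fun hmem => ?_, ?_⟩
          · have := l.lt_size_of_mem_leftPattern _ hmem
            omega
          · rintro ⟨m, hm, hmj⟩
            exact hiP (by rwa [← Nat.add_left_cancel hmj])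
        · intro g hg
          simp only [eval, Bool.or_eq_false_iff]
          exact ⟨l.eval_eq_false_of_leftPattern fun j hj => hg j (Finset.mem_union_left _ hj),
            hf _ fun j hj => hg _ (Finset.mem_union_right _ (Finset.mem_map_of_mem _ hj))⟩

end Shape

/-- The value of a literal under an assignment. -/
def litVal (x : ℕ → Bool) (y : ℕ × Bool) : Bool := if y.2 then x y.1 else !(x y.1)

/-- The opposite literal. -/
def negLit (y : ℕ × Bool) : ℕ × Bool := (y.1, !y.2)

@[simp] theorem negLit_negLit (y : ℕ × Bool) : negLit (negLit y) = y := by simp [negLit]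

/-- The labelling `lab` of the leaves of `s` yields a tautology. -/
def Tautological (s : Shape) (lab : ℕ → ℕ × Bool) : Prop :=
  ∀ x : ℕ → Bool, s.eval (fun i => litVal x (lab i)) = true

/-- The pairs of positions in `P` carrying opposite literals. -/
def oppositePairs (lab : ℕ → ℕ × Bool) (P : Finset ℕ) : Finset (ℕ × ℕ) :=
  (P ×ˢ P).filter fun p => p.1 < p.2 ∧ lab p.1 = negLit (lab p.2)

theorem mem_oppositePairs {lab : ℕ → ℕ × Bool} {P : Finset ℕ} {p : ℕ × ℕ} :
    p ∈ oppositePairs lab P ↔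
      (p.1 ∈ P ∧ p.2 ∈ P) ∧ p.1 < p.2 ∧ lab p.1 = negLit (lab p.2) := by
  rw [oppositePairs, Finset.mem_filter, Finset.mem_product]

theorem oppositePairs_mono (lab : ℕ → ℕ × Bool) {P Q : Finset ℕ} (h : P ⊆ Q) :
    oppositePairs lab P ⊆ oppositePairs lab Q :=
  Finset.filter_subset_filter _ (Finset.product_subset_product h h)

theorem Tautological.exists_oppositePair {s : Shape} {lab : ℕ → ℕ × Bool} (h : Tautological s lab)
    {P : Finset ℕ} (hP : ∀ g : ℕ → Bool, (∀ i ∈ P, g i = false) → s.eval g = false) :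
    (oppositePairs lab P).Nonempty := by
  classical
  by_contra hne
  rw [Finset.not_nonempty_iff_eq_empty] at hne
  have hno : ∀ i ∈ P, ∀ j ∈ P, lab i ≠ negLit (lab j) := by
    intro i hi j hj hij
    have hempty : ∀ p, p ∉ oppositePairs lab P := by simp [hne]
    rcases lt_trichotomy i j with hlt | rfl | hlt
    · exact hempty (i, j) (mem_oppositePairs.mpr ⟨⟨hi, hj⟩, hlt, hij⟩)
    · have := congrArg Prod.snd hij
      simp [negLit] at this
    · exact hempty (j, i) (mem_oppositePairs.mpr ⟨⟨hj, hi⟩, hlt, by rw [hij, negLit_negLit]⟩)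
  have := h fun v => !decide (∃ i ∈ P, lab i = (v, true))
  rw [hP] at this
  · exact Bool.false_ne_true this
  · intro i hi
    rcases hl : lab i with ⟨v, b⟩
    cases b
    · have : ¬ ∃ j ∈ P, lab j = (v, true) := by
        rintro ⟨j, hj, hjl⟩
        exact hno j hj i hi (by simp [hl, hjl, negLit])
      simp [litVal, this]
    · have : ∃ j ∈ P, lab j = (v, true) := ⟨i, hi, hl⟩
      simp [litVal, this]

theorem tautological_of_oppositePair {s : Shape} {lab : ℕ → ℕ × Bool}
    (h : (oppositePairs lab s.orLeaves).Nonempty) : Tautological s lab := by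
  obtain ⟨p, hp⟩ := h
  obtain ⟨⟨h1, h2⟩, _, h3⟩ := mem_oppositePairs.mp hp
  intro x
  rcases hv : litVal x (lab p.2) with _ | _
  · refine s.eval_eq_true_of_orLeaves h1 ?_
    rw [h3]
    revert hv
    rcases lab p.2 with ⟨v, b⟩
    cases b <;> simp [litVal, negLit]
  · exact s.eval_eq_true_of_orLeaves h2 hv

/-- Up to the number of pairs of distinct opposite pairs in the full pattern, the indicator of
tautologies is the number of opposite pairs linked to the root by `∨` only. -/
theorem abs_indicator_tautological_sub_le (s : Shape) (lab : ℕ → ℕ × Bool)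
    [Decidable (Tautological s lab)] :
    |(if Tautological s lab then (1 : ℝ) else 0) - (oppositePairs lab s.orLeaves).card| ≤
      (oppositePairs lab s.fullPattern).offDiag.card := by
  have hmono := oppositePairs_mono lab s.orLeaves_subset_fullPattern
  rcases Finset.eq_empty_or_nonempty (oppositePairs lab s.orLeaves) with hX | hX
  · rw [hX, Finset.card_empty, Nat.cast_zero, sub_zero]
    split_ifs with ht
    · rw [abs_one, Nat.one_le_cast, Nat.succ_le_iff, Finset.card_pos]
      have hempty : ∀ p, p ∉ oppositePairs lab s.orLeaves := by simp [hX]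
      obtain ⟨p, hp⟩ := ht.exists_oppositePair (P := s.leftPattern)
        fun g => s.eval_eq_false_of_leftPattern
      have hp' := mem_oppositePairs.mp hp
      have hpf := oppositePairs_mono lab s.leftPattern_subset_fullPattern hp
      have havoid : ∃ i, (i = p.1 ∨ i = p.2) ∧ i ∈ s.leftPattern ∧ i ∉ s.orLeaves := by
        by_cases h1 : p.1 ∈ s.orLeaves
        · refine ⟨p.2, Or.inr rfl, hp'.1.2, fun h2 => hempty p ?_⟩
          exact mem_oppositePairs.mpr ⟨⟨h1, h2⟩, hp'.2⟩
        · exact ⟨p.1, Or.inl rfl, hp'.1.1, h1⟩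
      obtain ⟨i, hip, hi, hi'⟩ := havoid
      obtain ⟨P, hP, hiP, hf⟩ := s.exists_falsifying_avoiding hi hi'
      obtain ⟨q, hq⟩ := ht.exists_oppositePair hf
      refine ⟨(p, q), Finset.mem_offDiag.mpr ⟨hpf, oppositePairs_mono lab hP hq, ?_⟩⟩
      intro hpq
      change p = q at hpq
      subst hpq
      have := (mem_oppositePairs.mp hq).1
      rcases hip with rfl | rfl
      · exact hiP this.1
      · exact hiP this.2
    · simp
  · rw [if_pos (tautological_of_oppositePair hX)]
    have h1 : (1 : ℝ) ≤ (oppositePairs lab s.orLeaves).card := by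
      exact_mod_cast Finset.card_pos.mpr hX
    have h2 : ((oppositePairs lab s.orLeaves).offDiag.card : ℝ) ≤
        (oppositePairs lab s.fullPattern).offDiag.card := by
      exact_mod_cast Finset.card_le_card (Finset.offDiag_mono hmono)
    rw [Finset.offDiag_card, Nat.cast_sub (Nat.le_mul_self _), Nat.cast_mul] at h2
    rw [abs_sub_comm, abs_of_nonneg (by linarith)]
    nlinarith

/-- The number of distinct variables in a list of literals. -/
def numVars (l : List (ℕ × Bool)) : ℕ := (l.map Prod.fst).toFinset.card

/-- Canonical labellings: read from the right, new variables appear in increasing order, and each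
appears first as a positive literal. -/
def IsCanon : List (ℕ × Bool) → Prop
  | [] => True
  | x :: l => IsCanon l ∧ (x.1 < numVars l ∨ x = (numVars l, true))

theorem numVars_cons_of_mem {x : ℕ × Bool} {l : List (ℕ × Bool)} (h : x.1 ∈ l.map Prod.fst) :
    numVars (x :: l) = numVars l := by
  simp only [numVars, List.map_cons, List.toFinset_cons]
  rw [Finset.insert_eq_of_mem (List.mem_toFinset.mpr h)]

theorem numVars_cons_of_notMem {x : ℕ × Bool} {l : List (ℕ × Bool)} (h : x.1 ∉ l.map Prod.fst) :
    numVars (x :: l) = numVars l + 1 := by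
  simp only [numVars, List.map_cons, List.toFinset_cons]
  rw [Finset.card_insert_of_notMem fun h' => h (List.mem_toFinset.mp h')]

theorem IsCanon.mem_vars_iff {l : List (ℕ × Bool)} (h : IsCanon l) (v : ℕ) :
    v ∈ l.map Prod.fst ↔ v < numVars l := by
  induction l generalizing v with
  | nil => simp [numVars]
  | cons x l ih =>
    obtain ⟨hl, hx⟩ := h
    rcases hx with hx | rfl
    · have hx' := (ih hl x.1).mpr hx
      rw [numVars_cons_of_mem hx', List.map_cons, List.mem_cons, ih hl v]
      constructor
      · rintro (rfl | h)
        · exact hx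
        · exact h
      · exact Or.inr
    · have hx' : (numVars l, true).1 ∉ l.map Prod.fst := by rw [ih hl]; simp
      rw [numVars_cons_of_notMem hx', List.map_cons, List.mem_cons, ih hl v]
      omega

/-- The canonical labellings of length `n` with `p` variables. -/
def canonLists : ℕ → ℕ → Finset (List (ℕ × Bool))
  | 0, 0 => {[]}
  | 0, _ + 1 => ∅
  | _ + 1, 0 => ∅
  | n + 1, p + 1 =>
    ((Finset.range (p + 1) ×ˢ (Finset.univ : Finset Bool)) ×ˢ canonLists n (p + 1)).image
      (fun y => y.1 :: y.2) ∪ (canonLists n p).image fun l => (p, true) :: l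

theorem mem_canonLists {n p : ℕ} {l : List (ℕ × Bool)} :
    l ∈ canonLists n p ↔ l.length = n ∧ IsCanon l ∧ numVars l = p := by
  induction n generalizing p l with
  | zero =>
    rcases p with _ | p
    · simp only [canonLists, Finset.mem_singleton, List.length_eq_zero_iff]
      constructor
      · rintro rfl; simp [IsCanon, numVars]
      · exact fun h => h.1
    · simp only [canonLists, Finset.notMem_empty, List.length_eq_zero_iff, false_iff]
      rintro ⟨rfl, _, h⟩
      simp [numVars] at h
  | succ n ih =>
    rcases l with _ | ⟨x, l⟩
    · rcases p with _ | p <;> simp [canonLists]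
    have hmem : IsCanon (x :: l) → x.1 < numVars (x :: l) := fun h =>
      (h.mem_vars_iff x.1).mp (by simp)
    rcases p with _ | p
    · simp only [canonLists, Finset.notMem_empty, false_iff]
      rintro ⟨_, h, h0⟩
      have := hmem h
      omega
    · simp only [canonLists, Finset.mem_union, Finset.mem_image, Finset.mem_product,
        Finset.mem_range, Finset.mem_univ, and_true, List.length_cons, Nat.add_right_cancel_iff]
      constructor
      · rintro (⟨⟨y, l'⟩, ⟨hy, hl'⟩, h⟩ | ⟨l', hl', h⟩)
        · simp only [List.cons.injEq] at h
          obtain ⟨rfl, rfl⟩ := h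
          obtain ⟨h1, h2, h3⟩ := ih.mp hl'
          refine ⟨h1, ⟨h2, Or.inl (by rwa [h3])⟩, ?_⟩
          rw [numVars_cons_of_mem ((h2.mem_vars_iff _).mpr (by rwa [h3])), h3]
        · simp only [List.cons.injEq] at h
          obtain ⟨rfl, rfl⟩ := h
          obtain ⟨h1, h2, h3⟩ := ih.mp hl'
          refine ⟨h1, ⟨h2, Or.inr (by rw [h3])⟩, ?_⟩
          rw [numVars_cons_of_notMem (by rw [h2.mem_vars_iff]; omega), h3]
      · rintro ⟨h1, ⟨h2, h3⟩, h4⟩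
        rcases h3 with h3 | rfl
        · rw [numVars_cons_of_mem ((h2.mem_vars_iff _).mpr h3)] at h4
          exact Or.inl ⟨(x, l), ⟨by rwa [← h4], ih.mpr ⟨h1, h2, h4⟩⟩, rfl⟩
        · rw [numVars_cons_of_notMem (by rw [h2.mem_vars_iff]; simp)] at h4
          have h5 : numVars l = p := by omega
          exact Or.inr ⟨l, ih.mpr ⟨h1, h2, h5⟩, by rw [h5]⟩

theorem card_canonLists_succ (n p : ℕ) : (canonLists (n + 1) (p + 1)).card =
    2 * (p + 1) * (canonLists n (p + 1)).card + (canonLists n p).card := by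
  rw [canonLists, Finset.card_union_of_disjoint, Finset.card_image_of_injective,
    Finset.card_image_of_injective, Finset.card_product, Finset.card_product, Finset.card_range,
    Finset.card_univ, Fintype.card_bool, mul_comm (p + 1) 2]
  · intro l l' h
    simpa using h
  · rintro ⟨x, l⟩ ⟨x', l'⟩ h
    simpa using h
  · rw [Finset.disjoint_left]
    intro l hl hl'
    simp only [Finset.mem_image, Finset.mem_product, mem_canonLists] at hl hl'
    obtain ⟨⟨y, l₁⟩, ⟨_, h1⟩, rfl⟩ := hl
    obtain ⟨l₂, h2, h⟩ := hl'
    simp only [List.cons.injEq] at h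
    obtain ⟨_, rfl⟩ := h
    have h3 := h1.2.2
    have h4 := h2.2.2
    dsimp only at h3 h4
    omega

theorem card_canonLists (n p : ℕ) :
    ((canonLists n p).card : ℝ) = 2 ^ n * (stirling n p / 2 ^ p) := by
  induction n generalizing p with
  | zero => rcases p with _ | p <;> simp [canonLists, stirling]
  | succ n ih =>
    rcases p with _ | p
    · simp [canonLists, stirling]
    · rw [card_canonLists_succ, stirling]
      push_cast
      rw [ih, ih]
      field_simp
      ring

/-- The canonical labellings of length `n` with at most `K` variables. -/
def labelings (n K : ℕ) : Finset (List (ℕ × Bool)) :=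
  (Finset.range (K + 1)).biUnion fun p => canonLists n p

theorem mem_labelings {n K : ℕ} {l : List (ℕ × Bool)} :
    l ∈ labelings n K ↔ l.length = n ∧ IsCanon l ∧ numVars l ≤ K := by
  simp only [labelings, Finset.mem_biUnion, Finset.mem_range, mem_canonLists]
  constructor
  · rintro ⟨p, hp, h1, h2, rfl⟩
    exact ⟨h1, h2, by omega⟩
  · rintro ⟨h1, h2, h3⟩
    exact ⟨_, by omega, h1, h2, rfl⟩

theorem card_labelings {n : ℕ} (hn : 1 ≤ n) (K : ℕ) :
    ((labelings n K).card : ℝ) = 2 ^ n * B n K := by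
  rw [labelings, Finset.card_biUnion]
  · push_cast
    simp only [card_canonLists]
    rw [← Finset.mul_sum, Finset.sum_range_succ', B, Finset.range_eq_Ico,
      Finset.sum_Ico_add' (fun p => (stirling n p : ℝ) / 2 ^ p)]
    obtain ⟨m, rfl⟩ := Nat.exists_eq_add_of_le' hn
    simp only [stirling, Nat.cast_zero, zero_div, add_zero, zero_add]
    rfl
  · intro p _ q _ hpq
    rw [Function.onFun, Finset.disjoint_left]
    intro l hl hl'
    rw [mem_canonLists] at hl hl'
    omega

theorem numVars_append_cons {u w : List (ℕ × Bool)} {y : ℕ × Bool} (h : y.1 ∈ w.map Prod.fst) :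
    numVars (u ++ y :: w) = numVars (u ++ w) := by
  simp only [numVars]
  congr 1
  ext v
  simp only [List.map_append, List.map_cons, List.mem_toFinset, List.mem_append, List.mem_cons]
  constructor
  · rintro (h' | rfl | h')
    exacts [Or.inl h', Or.inr h, Or.inr h']
  · rintro (h' | h')
    exacts [Or.inl h', Or.inr (Or.inr h')]

theorem isCanon_append_cons {u w : List (ℕ × Bool)} {y : ℕ × Bool} (h : y.1 ∈ w.map Prod.fst) :
    IsCanon (u ++ y :: w) ↔ IsCanon (u ++ w) := by
  induction u with
  | nil =>
    simp only [List.nil_append, IsCanon, and_iff_left_iff_imp]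
    exact fun hw => Or.inl ((hw.mem_vars_iff _).mp h)
  | cons x u ih =>
    simp only [List.cons_append, IsCanon, ih, numVars_append_cons h]

theorem append_cons_mem_labelings {u w : List (ℕ × Bool)} {y : ℕ × Bool} {n K : ℕ}
    (h : y.1 ∈ w.map Prod.fst) :
    u ++ y :: w ∈ labelings (n + 1) K ↔ u ++ w ∈ labelings n K := by
  rw [mem_labelings, mem_labelings, isCanon_append_cons h, numVars_append_cons h]
  simp only [List.length_append, List.length_cons]
  constructor <;> rintro ⟨h1, h2⟩ <;> exact ⟨by omega, h2⟩

/-- The literal carried by the `i`-th leaf. -/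
abbrev litAt (l : List (ℕ × Bool)) (i : ℕ) : ℕ × Bool := l.getD i (0, true)

theorem eq_take_append_litAt_cons {l : List (ℕ × Bool)} {j : ℕ} (hj : j < l.length) :
    l = l.take j ++ litAt l j :: l.drop (j + 1) := by
  rw [litAt, List.getD_eq_getElem _ _ hj, ← List.drop_eq_getElem_cons hj, List.take_append_drop]

theorem litAt_eraseIdx {l : List (ℕ × Bool)} {i j : ℕ} (h : j ≤ i) :
    litAt (l.eraseIdx j) i = litAt l (i + 1) := by
  simp only [litAt, List.getD_eq_getElem?_getD, List.getElem?_eraseIdx, if_neg (not_lt.mpr h)]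

theorem litAt_fst_mem {l : List (ℕ × Bool)} {i : ℕ} (hi : i < l.length) :
    (litAt l i).1 ∈ l.map Prod.fst := by
  rw [litAt, List.getD_eq_getElem _ _ hi]
  exact List.mem_map_of_mem (List.getElem_mem hi)

theorem litAt_mem_drop {l : List (ℕ × Bool)} {i j : ℕ} (hj : j ≤ i) (hi : i < l.length) :
    (litAt l i).1 ∈ (l.drop j).map Prod.fst := by
  have h : litAt l i = litAt (l.drop j) (i - j) := by
    simp only [litAt, List.getD_eq_getElem?_getD, List.getElem?_drop]
    congr 3
    omega
  rw [h]
  exact litAt_fst_mem (by rw [List.length_drop]; omega)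

/-- Erasing a leaf whose literal is determined by that of a later leaf. -/
theorem card_labelings_filter_eraseIdx (f : ℕ × Bool → ℕ × Bool) (hf : ∀ y, (f y).1 = y.1)
    {n K i j : ℕ} (hji : j ≤ i) (hi : i < n) (Q : List (ℕ × Bool) → Prop)
    [DecidablePred Q] :
    ((labelings (n + 1) K).filter fun l => litAt l j = f (litAt l (i + 1)) ∧
      Q (l.eraseIdx j)).card = ((labelings n K).filter Q).card := by
  refine Finset.card_nbij' (fun l => l.eraseIdx j)
    (fun l => l.take j ++ f (litAt l i) :: l.drop j) ?_ ?_ ?_ ?_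
  · intro l hl
    rw [Finset.mem_coe, Finset.mem_filter] at hl ⊢
    obtain ⟨hl, h1, h2⟩ := hl
    refine ⟨?_, h2⟩
    have hlen := (mem_labelings.mp hl).1
    change l.eraseIdx j ∈ labelings n K
    rw [eq_take_append_litAt_cons (l := l) (j := j) (by omega), append_cons_mem_labelings] at hl
    · rwa [List.eraseIdx_eq_take_drop_succ]
    · rw [h1, hf]
      exact litAt_mem_drop (by omega) (by omega)
  · intro l hl
    rw [Finset.mem_coe, Finset.mem_filter] at hl ⊢
    obtain ⟨hl, h2⟩ := hl
    have hlen := (mem_labelings.mp hl).1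
    have htake : (l.take j).length = j := by rw [List.length_take]; omega
    have herase : (l.take j ++ f (litAt l i) :: l.drop j).eraseIdx j = l := by
      rw [List.eraseIdx_append_of_length_le (by omega), htake, Nat.sub_self,
        List.eraseIdx_cons_zero, List.take_append_drop]
    refine ⟨?_, ?_, by rwa [herase]⟩
    · rw [append_cons_mem_labelings, List.take_append_drop]
      · exact hl
      · rw [hf]
        exact litAt_mem_drop hji (by omega)
    · rw [← litAt_eraseIdx hji, herase, litAt, List.getD_append_right _ _ _ _ (by omega), htake,
        Nat.sub_self, List.getD_cons_zero]
  · intro l hl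
    rw [Finset.mem_coe, Finset.mem_filter] at hl
    obtain ⟨hl, h1, _⟩ := hl
    have hlen := (mem_labelings.mp hl).1
    have htake : (l.take j).length = j := by rw [List.length_take]; omega
    change (l.eraseIdx j).take j ++ f (litAt (l.eraseIdx j) i) :: (l.eraseIdx j).drop j = l
    rw [litAt_eraseIdx hji, ← h1, List.eraseIdx_eq_take_drop_succ,
      List.take_append_of_le_length (by omega), List.drop_append_of_le_length (by omega),
      List.take_take, min_self, List.drop_take, Nat.sub_self, List.take_zero, List.nil_append]
    exact (eq_take_append_litAt_cons (by omega)).symm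
  · intro l hl
    rw [Finset.mem_coe, Finset.mem_filter] at hl
    have hlen := (mem_labelings.mp hl.1).1
    have htake : (l.take j).length = j := by rw [List.length_take]; omega
    change (l.take j ++ f (litAt l i) :: l.drop j).eraseIdx j = l
    rw [List.eraseIdx_append_of_length_le (by omega), htake, Nat.sub_self, List.eraseIdx_cons_zero,
      List.take_append_drop]

theorem card_labelings_filter {f : ℕ × Bool → ℕ × Bool} (hf : ∀ y, (f y).1 = y.1)
    {n K i j : ℕ} (hji : j < i) (hi : i < n + 1) :
    ((labelings (n + 1) K).filter fun l => litAt l j = f (litAt l i)).card =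
      (labelings n K).card := by
  obtain ⟨i, rfl⟩ := Nat.exists_eq_add_of_lt (Nat.zero_lt_of_lt hji)
  have := card_labelings_filter_eraseIdx f hf (n := n) (K := K) (i := i) (j := j)
    (by omega) (by omega) fun _ => True
  simpa using this

theorem card_labelings_filter_two_le {n K : ℕ} {p q : ℕ × ℕ} (hpq : p ≠ q)
    (hp : p.1 < p.2) (hp' : p.2 < n + 2) (hq : q.1 < q.2) (hq' : q.2 < n + 2) :
    ((labelings (n + 2) K).filter fun l => litAt l p.1 = negLit (litAt l p.2) ∧
      litAt l q.1 = negLit (litAt l q.2)).card ≤ (labelings n K).card := by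
  have key : ∀ p q : ℕ × ℕ, p.1 < p.2 → p.2 < n + 2 → q.1 < q.2 → q.2 < n + 2 →
      (p.1 < q.1 ∨ p.1 = q.1 ∧ p.2 < q.2) →
      ((labelings (n + 2) K).filter fun l => litAt l p.1 = negLit (litAt l p.2) ∧
        litAt l q.1 = negLit (litAt l q.2)).card ≤ (labelings n K).card := by
    rintro ⟨j, i⟩ ⟨j', i'⟩ hp hp' hq hq' h
    dsimp only at *
    obtain ⟨i, rfl⟩ := Nat.exists_eq_add_of_lt (Nat.zero_lt_of_lt hp)
    obtain ⟨i', rfl⟩ := Nat.exists_eq_add_of_lt (Nat.zero_lt_of_lt hq)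
    simp only [zero_add] at *
    rcases h with h | ⟨rfl, h⟩
    · obtain ⟨j', rfl⟩ := Nat.exists_eq_add_of_lt (Nat.zero_lt_of_lt h)
      simp only [zero_add] at *
      rw [← card_labelings_filter (n := n) (K := K) (f := negLit) (fun _ => rfl) (i := i')
        (j := j') (by omega) (by omega),
        ← card_labelings_filter_eraseIdx negLit (fun _ => rfl) (n := n + 1) (K := K) (i := i)
          (j := j) (by omega) (by omega) fun l => litAt l j' = negLit (litAt l i')]
      refine Finset.card_le_card fun l hl => ?_
      rw [Finset.mem_filter] at hl ⊢
      rw [litAt_eraseIdx (by omega), litAt_eraseIdx (by omega)]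
      exact hl
    · refine le_of_le_of_eq ?_ ((card_labelings_filter_eraseIdx negLit (fun _ => rfl) (n := n + 1)
        (K := K) (i := i) (j := j) (by omega) (by omega)
        fun l => litAt l i = id (litAt l i')).trans (card_labelings_filter (fun _ => rfl)
        (by omega) (by omega)))
      refine Finset.card_le_card fun l hl => ?_
      rw [Finset.mem_filter] at hl ⊢
      rw [litAt_eraseIdx (by omega), litAt_eraseIdx (by omega)]
      refine ⟨hl.1, hl.2.1, ?_⟩
      have := hl.2.1.symm.trans hl.2.2
      rw [← negLit_negLit (litAt l (i + 1)), this, negLit_negLit, id]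
  rcases lt_trichotomy p.1 q.1 with h | h | h
  · exact key p q hp hp' hq hq' (Or.inl h)
  · rcases lt_trichotomy p.2 q.2 with h2 | h2 | h2
    · exact key p q hp hp' hq hq' (Or.inr ⟨h, h2⟩)
    · exact absurd (Prod.ext h h2) hpq
    · simp only [and_comm (a := litAt _ p.1 = _)]
      exact key q p hq hq' hp hp' (Or.inr ⟨h.symm, h2⟩)
  · simp only [and_comm (a := litAt _ p.1 = _)]
    exact key q p hq hq' hp hp' (Or.inl h)

/-- The substitution of the literal `ρ v` for each variable `v`. -/
def litMap (ρ : ℕ → ℕ × Bool) (y : ℕ × Bool) : ℕ × Bool := ((ρ y.1).1, y.2 == (ρ y.1).2)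

theorem exists_isCanon_map (l : List (ℕ × Bool)) : ∃ ρ : ℕ → ℕ × Bool,
    (∀ v ∈ l.map Prod.fst, ∀ w ∈ l.map Prod.fst, (ρ v).1 = (ρ w).1 → v = w) ∧
      IsCanon (l.map (litMap ρ)) := by
  induction l with
  | nil => exact ⟨fun v => (v, true), by simp, trivial⟩
  | cons x l ih =>
    obtain ⟨ρ, hinj, hl⟩ := ih
    have hmem : ∀ v ∈ l.map Prod.fst, (ρ v).1 < numVars (l.map (litMap ρ)) := by
      intro v hv
      rw [← hl.mem_vars_iff]
      obtain ⟨y, hy, rfl⟩ := List.mem_map.mp hv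
      exact List.mem_map.mpr ⟨_, List.mem_map_of_mem hy, rfl⟩
    by_cases hx : x.1 ∈ l.map Prod.fst
    · refine ⟨ρ, ?_, hl, Or.inl (hmem _ hx)⟩
      have hsub : ∀ v ∈ (x :: l).map Prod.fst, v ∈ l.map Prod.fst := by
        intro v hv
        rcases List.mem_cons.mp hv with rfl | hv
        exacts [hx, hv]
      exact fun v hv w hw => hinj v (hsub v hv) w (hsub w hw)
    · set N := numVars (l.map (litMap ρ)) with hN
      have hne : ∀ v ∈ l.map Prod.fst, Function.update ρ x.1 (N, x.2) v = ρ v := fun v hv =>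
        Function.update_of_ne (by rintro rfl; exact hx hv) _ _
      have hmap : l.map (litMap (Function.update ρ x.1 (N, x.2))) = l.map (litMap ρ) := by
        refine List.map_congr_left fun y hy => ?_
        simp only [litMap, hne y.1 (List.mem_map_of_mem hy)]
      refine ⟨Function.update ρ x.1 (N, x.2), ?_, ?_⟩
      · intro v hv w hw h
        rcases List.mem_cons.mp hv with rfl | hv <;> rcases List.mem_cons.mp hw with rfl | hw
        · rfl
        · rw [Function.update_self, hne w hw] at h
          have := hmem w hw
          dsimp only at h
          omega
        · rw [Function.update_self, hne v hv] at h
          have := hmem v hv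
          dsimp only at h
          omega
        · rw [hne v hv, hne w hw] at h
          exact hinj v hv w hw h
      · rw [List.map_cons, IsCanon, hmap]
        exact ⟨hl, Or.inr (by simp [litMap, hN])⟩

theorem exists_litAt_fst_eq {l : List (ℕ × Bool)} {v : ℕ} (h : v ∈ l.map Prod.fst) :
    ∃ i < l.length, (litAt l i).1 = v := by
  obtain ⟨y, hy, rfl⟩ := List.mem_map.mp h
  obtain ⟨i, hi, rfl⟩ := List.mem_iff_getElem.mp hy
  exact ⟨i, hi, by rw [litAt, List.getD_eq_getElem _ _ hi]⟩

theorem IsCanon.ext {l l' : List (ℕ × Bool)} (hl : IsCanon l) (hl' : IsCanon l')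
    (hlen : l.length = l'.length)
    (h : ∀ i j : ℕ, i < l.length → j < l.length →
      ((litAt l i).1 = (litAt l j).1 ↔ (litAt l' i).1 = (litAt l' j).1) ∧
        (litAt l i = litAt l j ↔ litAt l' i = litAt l' j)) : l = l' := by
  induction l generalizing l' with
  | nil => exact (List.length_eq_zero_iff.mp hlen.symm).symm
  | cons x l ih =>
    rcases l' with _ | ⟨x', l'⟩
    · simp at hlen
    simp only [List.length_cons, Nat.add_right_cancel_iff] at hlen
    obtain rfl : l = l' := by
      refine ih hl.1 hl'.1 hlen fun i j hi hj => ?_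
      simpa [litAt] using h (i + 1) (j + 1) (by simpa using hi) (by simpa using hj)
    have hx : ∀ i < l.length, (x.1 = (litAt l i).1 ↔ x'.1 = (litAt l i).1) ∧
        (x = litAt l i ↔ x' = litAt l i) := by
      intro i hi
      simpa [litAt] using h 0 (i + 1) (by simp) (by simpa using hi)
    congr 1
    rcases hl.2 with h1 | h1
    · obtain ⟨i, hi, hv⟩ := exists_litAt_fst_eq ((hl.1.mem_vars_iff _).mpr h1)
      obtain ⟨h2, h3⟩ := hx i hi
      have h4 := h2.mp hv.symm
      have h5 : x.2 = x'.2 := by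
        simp only [Prod.ext_iff, hv.symm, h4] at h3
        simp only [true_and] at h3
        revert h3
        cases x.2 <;> cases x'.2 <;> cases (litAt l i).2 <;> simp
      exact Prod.ext (hv.symm.trans h4.symm) h5
    · rcases hl'.2 with h1' | h1'
      · obtain ⟨i, hi, hv⟩ := exists_litAt_fst_eq ((hl.1.mem_vars_iff _).mpr h1')
        have h4 := (hx i hi).1.mpr hv.symm
        rw [hv, h1] at h4
        dsimp only at h4
        omega
      · rw [h1, h1']

namespace AOTree

/-- The substitution of literals for variables in a tree. -/
def substLits (ρ : ℕ → ℕ × Bool) : AOTree → AOTree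
  | .leaf v b => .leaf (litMap ρ (v, b)).1 (litMap ρ (v, b)).2
  | .node c l r => .node c (l.substLits ρ) (r.substLits ρ)

@[simp] theorem leaves_substLits (ρ : ℕ → ℕ × Bool) (t : AOTree) :
    (t.substLits ρ).leaves = t.leaves.map (litMap ρ) := by
  induction t with
  | leaf v b => rfl
  | node c l r ihl ihr => simp [substLits, leaves, ihl, ihr]

@[simp] theorem shape_substLits (ρ : ℕ → ℕ × Bool) (t : AOTree) :
    (t.substLits ρ).shape = t.shape := by
  induction t with
  | leaf v b => rfl
  | node c l r ihl ihr => simp [substLits, shape, ihl, ihr]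

theorem eval_substLits (ρ : ℕ → ℕ × Bool) (t : AOTree) (x : ℕ → Bool) :
    (t.substLits ρ).eval x = t.eval fun v => (ρ v).2 == x (ρ v).1 := by
  induction t with
  | leaf v b =>
    simp only [substLits, litMap, eval]
    cases b <;> cases (ρ v).2 <;> cases x (ρ v).1 <;> rfl
  | node c l r ihl ihr => cases c <;> simp [substLits, eval, ihl, ihr]

theorem size_substLits (ρ : ℕ → ℕ × Bool) (t : AOTree) : (t.substLits ρ).size = t.size := by
  simp [size]

theorem varCount_substLits_le (ρ : ℕ → ℕ × Bool) (t : AOTree) :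
    (t.substLits ρ).varCount ≤ t.varCount := by
  rw [varCount, varCount, leaves_substLits, List.map_map]
  have : ((t.leaves.map (Prod.fst ∘ litMap ρ)).toFinset) =
      (t.leaves.map Prod.fst).toFinset.image fun v => (ρ v).1 := by
    ext v
    simp [litMap]
  rw [this]
  exact Finset.card_image_le

theorem shape_size (t : AOTree) : t.shape.size = t.leaves.length := by
  induction t with
  | leaf v b => rfl
  | node c l r ihl ihr => simp [shape, Shape.size, leaves, ihl, ihr]

/-- The dual tree. -/
def dual : AOTree → AOTree
  | .leaf v b => .leaf v b
  | .node .and l r => .node .or l.dual r.dual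
  | .node .or l r => .node .and l.dual r.dual

@[simp] theorem dual_dual (t : AOTree) : t.dual.dual = t := by
  induction t with
  | leaf v b => rfl
  | node c l r ihl ihr => cases c <;> simp [dual, ihl, ihr]

@[simp] theorem leaves_dual (t : AOTree) : t.dual.leaves = t.leaves := by
  induction t with
  | leaf v b => rfl
  | node c l r ihl ihr => cases c <;> simp [dual, leaves, ihl, ihr]

theorem eval_dual (t : AOTree) (x : ℕ → Bool) : t.dual.eval x = !t.eval fun v => !x v := by
  induction t with
  | leaf v b => cases b <;> simp [dual, eval]
  | node c l r ihl ihr => cases c <;> simp [dual, eval, ihl, ihr]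

theorem eval_dual_eq_const_iff (t : AOTree) (b : Bool) :
    t.dual.eval = (fun _ => !b) ↔ t.eval = fun _ => b := by
  constructor
  · intro h
    funext x
    have := congrFun h fun v => !x v
    simpa [eval_dual] using this
  · intro h
    funext x
    rw [eval_dual, h]

end AOTree

theorem TreeEquiv.refl (A : AOTree) : TreeEquiv A A := ⟨rfl, fun _ _ _ _ => ⟨Iff.rfl, Iff.rfl⟩⟩

theorem TreeEquiv.length_eq {A A' : AOTree} (h : TreeEquiv A A') :
    A.leaves.length = A'.leaves.length := by
  rw [← A.shape_size, ← A'.shape_size, h.1]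

theorem TreeEquiv.symm {A A' : AOTree} (h : TreeEquiv A A') : TreeEquiv A' A := by
  refine ⟨h.1.symm, fun i j hi hj => ?_⟩
  rw [← h.length_eq] at hi hj
  exact ⟨(h.2 i j hi hj).1.symm, (h.2 i j hi hj).2.symm⟩

theorem TreeEquiv.trans {A A' A'' : AOTree} (h : TreeEquiv A A') (h' : TreeEquiv A' A'') :
    TreeEquiv A A'' := by
  refine ⟨h.1.trans h'.1, fun i j hi hj => ?_⟩
  have h2 := h'.2 i j (h.length_eq ▸ hi) (h.length_eq ▸ hj)
  exact ⟨(h.2 i j hi hj).1.trans h2.1, (h.2 i j hi hj).2.trans h2.2⟩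

theorem treeEquiv_substLits {A : AOTree} {ρ : ℕ → ℕ × Bool}
    (hρ : ∀ v ∈ A.leaves.map Prod.fst, ∀ w ∈ A.leaves.map Prod.fst,
      (ρ v).1 = (ρ w).1 → v = w) : TreeEquiv A (A.substLits ρ) := by
  refine ⟨(A.shape_substLits ρ).symm, fun i j hi hj => ?_⟩
  have hlv : ∀ i < A.leaves.length, lv (A.substLits ρ) i = litMap ρ (lv A i) := by
    intro i hi
    rw [lv, lv, AOTree.leaves_substLits, List.getD_eq_getElem _ _ hi,
      List.getD_eq_getElem _ _ (by simpa using hi), List.getElem_map]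
  have hv := hρ _ (litAt_fst_mem hi) _ (litAt_fst_mem hj)
  change _ → (lv A i).1 = (lv A j).1 at hv
  rw [hlv i hi, hlv j hj]
  constructor
  · exact ⟨fun h => by simp only [litMap, h], hv⟩
  · refine ⟨fun h => by rw [h], fun h => ?_⟩
    simp only [litMap, Prod.mk.injEq] at h
    have h1 := hv h.1
    have h2 := h.2
    rw [h1] at h2
    refine Prod.ext h1 ?_
    revert h2
    cases (lv A i).2 <;> cases (lv A j).2 <;> cases (ρ (lv A j).1).2 <;> simp

/-- The tree with a given structure and given leaf labels. -/
def fill : Shape → List (ℕ × Bool) → AOTree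
  | .leaf, l => .leaf (litAt l 0).1 (litAt l 0).2
  | .node c l r, ls => .node c (fill l (ls.take l.size)) (fill r (ls.drop l.size))

@[simp] theorem fill_shape_leaves (t : AOTree) : fill t.shape t.leaves = t := by
  induction t with
  | leaf v b => rfl
  | node c l r ihl ihr => simp [AOTree.shape, AOTree.leaves, fill, AOTree.shape_size, ihl, ihr]

theorem shape_fill (s : Shape) (l : List (ℕ × Bool)) : (fill s l).shape = s := by
  induction s generalizing l with
  | leaf => rfl
  | node c s s' ih ih' => simp [fill, AOTree.shape, ih, ih']

theorem leaves_fill {s : Shape} {l : List (ℕ × Bool)} (h : l.length = s.size) :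
    (fill s l).leaves = l := by
  induction s generalizing l with
  | leaf =>
    obtain ⟨y, rfl⟩ := List.length_eq_one_iff.mp h
    rfl
  | node c s s' ih ih' =>
    rw [Shape.size] at h
    rw [fill, AOTree.leaves, ih (by rw [List.length_take]; omega),
      ih' (by rw [List.length_drop]; omega), List.take_append_drop]

theorem Shape.eval_congr {s : Shape} {g g' : ℕ → Bool} (h : ∀ i < s.size, g i = g' i) :
    s.eval g = s.eval g' := by
  induction s generalizing g g' with
  | leaf => exact h 0 Nat.one_pos
  | node c l r ihl ihr =>
    simp only [size] at h
    have h1 := ihl (g := g) (g' := g') fun i hi => h i (by omega)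
    have h2 := ihr (g := fun i => g (l.size + i)) (g' := fun i => g' (l.size + i))
      fun i hi => h _ (by omega)
    cases c <;> simp only [eval, h1, h2]

theorem eval_eq_shape_eval (t : AOTree) (x : ℕ → Bool) :
    t.eval x = t.shape.eval fun i => litVal x (litAt t.leaves i) := by
  induction t with
  | leaf v b => rfl
  | node c l r ihl ihr =>
    have h1 : l.eval x =
        l.shape.eval fun i => litVal x (litAt (AOTree.node c l r).leaves i) := by
      rw [ihl]
      refine Shape.eval_congr fun i hi => ?_
      rw [l.shape_size] at hi
      rw [AOTree.leaves, litAt, litAt, List.getD_append _ _ _ _ hi]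
    have h2 : r.eval x = r.shape.eval fun i =>
        litVal x (litAt (AOTree.node c l r).leaves (l.shape.size + i)) := by
      rw [ihr]
      congr 1
      funext i
      rw [AOTree.leaves, l.shape_size, litAt, litAt, List.getD_append_right _ _ _ _ (by omega),
        Nat.add_sub_cancel_left]
    cases c <;> rw [AOTree.eval, h1, h2] <;> rfl

theorem eval_eq_true_iff (t : AOTree) :
    (t.eval = fun _ => true) ↔ Tautological t.shape (litAt t.leaves) := by
  simp only [funext_iff, Tautological, eval_eq_shape_eval]

theorem TreeEquiv.eq_of_isCanon {A A' : AOTree} (h : TreeEquiv A A') (hA : IsCanon A.leaves)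
    (hA' : IsCanon A'.leaves) : A = A' := by
  rw [← fill_shape_leaves A, ← fill_shape_leaves A', h.1, hA.ext hA' h.length_eq h.2]

/-- Each equivalence class contains exactly one canonically labelled tree. -/
theorem classCount_eq {P : AOTree → Prop} (hP : ∀ t ρ, P t → P (t.substLits ρ)) :
    classCount P = Nat.card {t // P t ∧ IsCanon t.leaves} := by
  refine (Nat.card_congr (Equiv.ofBijective
    (fun t : {t // P t ∧ IsCanon t.leaves} => Quot.mk _ (⟨t.1, t.2.1⟩ : {t // P t}))
    ⟨?_, ?_⟩)).symm
  · rintro ⟨t, ht, hc⟩ ⟨t', ht', hc'⟩ h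
    have hequiv : Equivalence fun A A' : {t // P t} => TreeEquiv A.1 A'.1 :=
      ⟨fun A => TreeEquiv.refl A.1, TreeEquiv.symm, TreeEquiv.trans⟩
    have := hequiv.eqvGen_iff.mp (Quot.eqvGen_exact h)
    exact Subtype.ext (this.eq_of_isCanon hc hc')
  · refine Quot.ind fun t => ?_
    obtain ⟨ρ, hinj, hc⟩ := exists_isCanon_map t.1.leaves
    refine ⟨⟨t.1.substLits ρ, hP _ _ t.2, by rwa [AOTree.leaves_substLits]⟩, (Quot.sound ?_).symm⟩
    exact treeEquiv_substLits hinj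

open Classical in
theorem card_canonical_trees (n K : ℕ) (Q : Shape → List (ℕ × Bool) → Prop) :
    Nat.card {t : AOTree // (t.size = n ∧ t.varCount ≤ K ∧ Q t.shape t.leaves) ∧
      IsCanon t.leaves} =
      ((shapes n ×ˢ labelings n K).filter fun p => Q p.1 p.2).card := by
  rw [← Finset.card_image_of_injOn (f := fun p : Shape × List (ℕ × Bool) => fill p.1 p.2)]
  · refine Nat.subtype_card _ fun t => ?_
    simp only [Finset.mem_image, Finset.mem_filter, Finset.mem_product, mem_shapes, mem_labelings]
    constructor
    · rintro ⟨⟨s, l⟩, ⟨⟨rfl, h1, h2, h3⟩, h4⟩, rfl⟩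
      dsimp only at *
      rw [AOTree.size, AOTree.varCount, leaves_fill h1, shape_fill]
      exact ⟨⟨h1, h3, h4⟩, h2⟩
    · rintro ⟨⟨h1, h2, h3⟩, h4⟩
      exact ⟨(t.shape, t.leaves), ⟨⟨t.shape_size.trans h1, h1, h4, h2⟩, h3⟩, fill_shape_leaves t⟩
  · rintro ⟨s, l⟩ hp ⟨s', l'⟩ hp' h
    simp only [Finset.coe_filter, Finset.mem_product, mem_shapes, mem_labelings,
      Set.mem_ofPred_eq] at hp hp'
    dsimp only at h
    have h1 := congrArg AOTree.shape h
    have h2 := congrArg AOTree.leaves h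
    rw [shape_fill, shape_fill] at h1
    rw [leaves_fill (by omega), leaves_fill (by omega)] at h2
    rw [h1, h2]

theorem Tcount_eq (n K : ℕ) : Tcount n K = (shapes n).card * (labelings n K).card := by
  classical
  have := card_canonical_trees n K fun _ _ => True
  simp only [and_true, Finset.filter_true] at this
  rw [Tcount, classCount_eq, this, Finset.card_product]
  rintro t ρ ⟨h1, h2⟩
  exact ⟨(t.size_substLits ρ).trans h1, (t.varCount_substLits_le ρ).trans h2⟩

theorem TcountEval_const (n K : ℕ) (b : Bool) : TcountEval n K (fun _ => b) =
    Nat.card {t : AOTree // (t.size = n ∧ t.varCount ≤ K ∧ t.eval = fun _ => b) ∧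
      IsCanon t.leaves} := by
  rw [TcountEval, classCount_eq]
  rintro t ρ ⟨h1, h2, h3⟩
  refine ⟨(t.size_substLits ρ).trans h1, (t.varCount_substLits_le ρ).trans h2, ?_⟩
  funext x
  rw [AOTree.eval_substLits, h3]

theorem TcountEval_false (n K : ℕ) :
    TcountEval n K (fun _ => false) = TcountEval n K fun _ => true := by
  rw [TcountEval_const, TcountEval_const]
  refine Nat.card_congr (Equiv.subtypeEquiv
    ⟨AOTree.dual, AOTree.dual, AOTree.dual_dual, AOTree.dual_dual⟩ fun t => ?_)
  simp only [Equiv.coe_fn_mk, AOTree.size, AOTree.varCount, AOTree.leaves_dual]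
  rw [← AOTree.eval_dual_eq_const_iff t false, Bool.not_false]

open Classical in
theorem TcountEval_true (n K : ℕ) : (TcountEval n K (fun _ => true) : ℝ) =
    ∑ s ∈ shapes n, ∑ l ∈ labelings n K,
      if Tautological s (litAt l) then (1 : ℝ) else 0 := by
  rw [TcountEval_const]
  simp only [eval_eq_true_iff]
  rw [card_canonical_trees n K fun s l => Tautological s (litAt l), ← Finset.sum_product',
    Finset.sum_boole]

theorem stirling_self (p : ℕ) : stirling p p = 1 ∧ ∀ q, p < q → stirling p q = 0 := by
  induction p with
  | zero =>
    refine ⟨rfl, fun q hq => ?_⟩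
    obtain ⟨q, rfl⟩ := Nat.exists_eq_add_of_le' hq
    rfl
  | succ p ih =>
    refine ⟨by simp [stirling, ih.1, ih.2 _ (Nat.lt_succ_self p)], fun q hq => ?_⟩
    obtain ⟨q, rfl⟩ := Nat.exists_eq_add_of_le' (Nat.zero_lt_of_lt hq)
    simp [stirling, ih.2 (q + 1) (by omega), ih.2 q (by omega)]

theorem mul_stirling_le (n p : ℕ) : p * stirling n p ≤ stirling (n + 1) p := by
  rcases p with _ | p
  · simp
  · rw [stirling]
    exact Nat.le_add_right _ _

theorem stirling_le_pow (n p : ℕ) : stirling n p ≤ (p + 1) ^ n := by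
  induction n generalizing p with
  | zero => rcases p with _ | p <;> simp [stirling]
  | succ n ih =>
    rcases p with _ | p
    · simp [stirling]
    · have h1 := ih (p + 1)
      have h2 : stirling n p ≤ (p + 1 + 1) ^ n :=
        (ih p).trans (Nat.pow_le_pow_left (by omega) n)
      calc stirling (n + 1) (p + 1) = (p + 1) * stirling n (p + 1) + stirling n p := rfl
        _ ≤ (p + 1) * (p + 1 + 1) ^ n + (p + 1 + 1) ^ n := by gcongr
        _ = (p + 1 + 1) ^ (n + 1) := by ring

theorem pow_le_pow_mul_stirling {n p : ℕ} (h : p ≤ n) : p ^ n ≤ p ^ p * stirling n p := by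
  induction n, h using Nat.le_induction with
  | base => simp [(stirling_self p).1]
  | succ n _ ih =>
    calc p ^ (n + 1) = p * p ^ n := by ring
      _ ≤ p * (p ^ p * stirling n p) := by gcongr
      _ = p ^ p * (p * stirling n p) := by ring
      _ ≤ p ^ p * stirling (n + 1) p := by gcongr; exact mul_stirling_le n p

theorem B_nonneg (n K : ℕ) : 0 ≤ B n K := Finset.sum_nonneg fun _ _ => by positivity

theorem B_mono (n : ℕ) : Monotone (B n) := fun _ _ h =>
  Finset.sum_le_sum_of_subset_of_nonneg (Finset.Icc_subset_Icc_right h) fun _ _ _ => by positivity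

theorem stirling_div_le_B (n : ℕ) {p K : ℕ} (hp : 1 ≤ p) (hK : p ≤ K) :
    (stirling n p : ℝ) / 2 ^ p ≤ B n K :=
  Finset.single_le_sum (f := fun p => (stirling n p : ℝ) / 2 ^ p) (fun _ _ => by positivity)
    (Finset.mem_Icc.mpr ⟨hp, hK⟩)

theorem B_pos {n K : ℕ} (hn : 1 ≤ n) (hK : 1 ≤ K) : 0 < B n K := by
  have h1 := pow_le_pow_mul_stirling hn
  have h2 := stirling_div_le_B n le_rfl hK
  have h3 : (1 : ℝ) ≤ stirling n 1 := by simpa using h1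
  have h4 : (0 : ℝ) < (stirling n 1 : ℝ) / 2 ^ 1 := by positivity
  linarith

theorem B_le_mul_pow (n M : ℕ) : B n M ≤ M * ((M : ℝ) + 1) ^ n := by
  have h : ∀ p ∈ Finset.Icc 1 M, (stirling n p : ℝ) / 2 ^ p ≤ ((M : ℝ) + 1) ^ n := by
    intro p hp
    have h1 : (stirling n p : ℝ) ≤ ((p : ℝ) + 1) ^ n := by exact_mod_cast stirling_le_pow n p
    have h2 : (p : ℝ) ≤ M := by exact_mod_cast (Finset.mem_Icc.mp hp).2
    calc (stirling n p : ℝ) / 2 ^ p ≤ stirling n p :=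
          div_le_self (Nat.cast_nonneg _) (one_le_pow₀ one_le_two)
      _ ≤ ((p : ℝ) + 1) ^ n := h1
      _ ≤ ((M : ℝ) + 1) ^ n := by gcongr
  have := Finset.sum_le_card_nsmul _ _ _ h
  rwa [Nat.card_Icc, Nat.add_sub_cancel, nsmul_eq_mul] at this

theorem mul_sub_le_B_succ (n M K : ℕ) : ((M : ℝ) + 1) * (B n K - B n M) ≤ B (n + 1) K := by
  rcases le_total K M with h | h
  · have h1 := B_mono n h
    have h2 : ((M : ℝ) + 1) * (B n K - B n M) ≤ 0 :=
      mul_nonpos_of_nonneg_of_nonpos (by positivity) (by linarith)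
    exact h2.trans (B_nonneg _ _)
  · have hsub := Finset.Icc_subset_Icc_right (a := 1) h
    rw [B, B, ← Finset.sum_sdiff hsub, add_sub_cancel_right, Finset.mul_sum, B]
    refine le_trans (Finset.sum_le_sum (g := fun p => (stirling (n + 1) p : ℝ) / 2 ^ p)
      fun p hp => ?_) (Finset.sum_le_sum_of_subset_of_nonneg Finset.sdiff_subset
        fun _ _ _ => by positivity)
    rw [Finset.mem_sdiff, Finset.mem_Icc, Finset.mem_Icc] at hp
    have h1 : ((M + 1 : ℕ) : ℝ) ≤ p := by exact_mod_cast (by omega : M + 1 ≤ p)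
    have h2 : (p : ℝ) * stirling n p ≤ stirling (n + 1) p := by exact_mod_cast mul_stirling_le n p
    push_cast at h1
    rw [← mul_div_assoc]
    gcongr
    exact (mul_le_mul_of_nonneg_right h1 (Nat.cast_nonneg _)).trans h2

/-- Labellings with few variables are negligible. -/
theorem eventually_two_mul_B_le (M : ℕ) :
    ∀ᶠ n in atTop, ∀ K, M + 2 ≤ K → 2 * B n M ≤ B n K := by
  have hlim : Tendsto (fun n : ℕ => (((M : ℝ) + 2) / (M + 1)) ^ n) atTop atTop :=
    tendsto_pow_atTop_atTop_of_one_lt (by rw [one_lt_div (by positivity)]; linarith)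
  filter_upwards [hlim.eventually_ge_atTop (2 * M * (2 * ((M : ℝ) + 2)) ^ (M + 2)),
    eventually_ge_atTop (M + 2)] with n hn hn2 K hK
  have h1 : ((M : ℝ) + 2) ^ n ≤ ((M : ℝ) + 2) ^ (M + 2) * stirling n (M + 2) := by
    exact_mod_cast pow_le_pow_mul_stirling hn2
  have h2 := stirling_div_le_B n (by omega : 1 ≤ M + 2) hK
  have h3 := B_le_mul_pow n M
  rw [div_pow, le_div_iff₀ (by positivity), mul_pow] at hn
  have h4 : (0 : ℝ) < ((M : ℝ) + 2) ^ (M + 2) := by positivity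
  have h5 : 2 ^ (M + 2) * (2 * (M * ((M : ℝ) + 1) ^ n)) ≤ stirling n (M + 2) := by
    refine le_of_mul_le_mul_left ?_ h4
    linarith
  rw [div_le_iff₀' (by positivity)] at h2
  have h6 : (2 : ℝ) ^ (M + 2) * (2 * B n M) ≤ 2 ^ (M + 2) * B n K := by
    refine le_trans ?_ (h5.trans h2)
    gcongr
  exact le_of_mul_le_mul_left h6 (by positivity)

theorem tendsto_B_div_B_succ {k : ℕ → ℕ} (hk : Tendsto k atTop atTop) :
    Tendsto (fun n => B n (k n) / B (n + 1) (k n)) atTop (nhds 0) := by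
  refine tendsto_order.mpr ⟨fun a ha => Eventually.of_forall fun n =>
    ha.trans_le (div_nonneg (B_nonneg _ _) (B_nonneg _ _)), fun a ha => ?_⟩
  obtain ⟨M, hM⟩ := exists_nat_gt (2 / a)
  filter_upwards [eventually_two_mul_B_le M, hk.eventually_ge_atTop (M + 2)] with n hn hkn
  have h1 := hn _ hkn
  have h2 := mul_sub_le_B_succ n M (k n)
  have h3 : 0 < B (n + 1) (k n) := B_pos (by omega) (by omega)
  have h4 : ((M : ℝ) + 1) * (B n (k n) / 2) ≤ B (n + 1) (k n) := by
    refine le_trans ?_ h2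
    gcongr
    linarith
  have h5 : 2 < a * (M + 1) := by
    rw [div_lt_iff₀' ha] at hM
    linarith
  rw [div_lt_iff₀ h3]
  have h6 : a * (((M : ℝ) + 1) * (B n (k n) / 2)) ≤ a * B (n + 1) (k n) := by gcongr
  rcases (B_nonneg n (k n)).eq_or_lt with h0 | h0
  · rw [← h0]
    positivity
  · nlinarith

theorem card_filter_lt (P : Finset ℕ) :
    ((((P ×ˢ P).filter fun p => p.1 < p.2).card : ℕ) : ℝ) = (P.card : ℝ) * (P.card - 1) / 2 := by
  have h1 : (P ×ˢ P).filter (fun p => p.1 < p.2) ∪ (P ×ˢ P).filter (fun p => p.2 < p.1) =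
      P.offDiag := by
    rw [← Finset.filter_or]
    ext p
    simp only [Finset.mem_filter, Finset.mem_product, Finset.mem_offDiag, ne_eq]
    rw [and_assoc, lt_or_lt_iff_ne, ne_eq]
  have h2 : Disjoint ((P ×ˢ P).filter fun p => p.1 < p.2)
      ((P ×ˢ P).filter fun p => p.2 < p.1) :=
    Finset.disjoint_filter.mpr fun p _ h h' => lt_asymm h h'
  have h3 : ((P ×ˢ P).filter fun p => p.2 < p.1).card =
      ((P ×ˢ P).filter fun p => p.1 < p.2).card := by
    refine Finset.card_nbij' Prod.swap Prod.swap ?_ ?_ (fun _ _ => rfl) fun _ _ => rfl <;>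
    · intro p hp
      simp only [Finset.coe_filter, Finset.mem_product, Set.mem_ofPred_eq, Prod.fst_swap,
        Prod.snd_swap] at hp ⊢
      exact ⟨hp.1.symm, hp.2⟩
  have h4 := congrArg Finset.card h1
  rw [Finset.card_union_of_disjoint h2, h3, Finset.offDiag_card] at h4
  have h5 := congrArg (Nat.cast : ℕ → ℝ) h4
  rw [Nat.cast_sub (Nat.le_mul_self _)] at h5
  push_cast at h5
  linarith

theorem sum_card_oppositePairs {n K : ℕ} {P : Finset ℕ} (hP : ∀ i ∈ P, i < n + 1) :
    ∑ l ∈ labelings (n + 1) K, ((oppositePairs (litAt l) P).card : ℝ) =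
      (P.card : ℝ) * (P.card - 1) / 2 * (labelings n K).card := by
  rw [← card_filter_lt, ← Nat.cast_sum, ← Nat.cast_mul]
  congr 1
  simp only [oppositePairs, ← Finset.filter_filter]
  refine (Finset.sum_card_bipartiteAbove_eq_sum_card_bipartiteBelow
    fun (l : List (ℕ × Bool)) (p : ℕ × ℕ) => litAt l p.1 = negLit (litAt l p.2)).trans ?_
  rw [Finset.card_eq_sum_ones, Finset.sum_mul]
  refine Finset.sum_congr rfl fun p hp => ?_
  rw [Finset.mem_filter, Finset.mem_product] at hp
  rw [one_mul]
  exact card_labelings_filter (f := negLit) (fun _ => rfl) hp.2 (hP _ hp.1.2)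

theorem sum_card_offDiag_oppositePairs_le {n K : ℕ} {P : Finset ℕ} (hP : ∀ i ∈ P, i < n + 2) :
    ∑ l ∈ labelings (n + 2) K, ((oppositePairs (litAt l) P).offDiag.card : ℝ) ≤
      (P.card : ℝ) ^ 4 * (labelings n K).card := by
  rw [← Nat.cast_sum]
  norm_cast
  set D := (((P ×ˢ P) ×ˢ (P ×ˢ P)).filter fun z =>
    z.1 ≠ z.2 ∧ z.1.1 < z.1.2 ∧ z.2.1 < z.2.2) with hD
  have h : ∀ l : List (ℕ × Bool), (oppositePairs (litAt l) P).offDiag =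
      D.filter fun z => litAt l z.1.1 = negLit (litAt l z.1.2) ∧
        litAt l z.2.1 = negLit (litAt l z.2.2) := by
    intro l
    ext z
    simp only [hD, Finset.mem_offDiag, mem_oppositePairs, Finset.mem_filter, Finset.mem_product]
    tauto
  simp only [h]
  refine (Finset.sum_card_bipartiteAbove_eq_sum_card_bipartiteBelow
    fun (l : List (ℕ × Bool)) (z : (ℕ × ℕ) × (ℕ × ℕ)) => litAt l z.1.1 = negLit (litAt l z.1.2) ∧
      litAt l z.2.1 = negLit (litAt l z.2.2)).trans_le ?_
  have hcard : D.card ≤ P.card ^ 4 := by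
    refine (Finset.card_filter_le _ _).trans_eq ?_
    simp only [Finset.card_product]
    ring
  refine (Finset.sum_le_card_nsmul _ _ (labelings n K).card fun z hz => ?_).trans ?_
  · rw [hD, Finset.mem_filter, Finset.mem_product, Finset.mem_product, Finset.mem_product] at hz
    exact card_labelings_filter_two_le hz.2.1 hz.2.2.1 (hP _ hz.1.1.2) hz.2.2.2 (hP _ hz.1.2.2)
  · rw [smul_eq_mul]
    gcongr

/-- The number of classes of tautologies, up to an error controlled by the labellings with two
fewer degrees of freedom. -/
theorem abs_TcountEval_true_sub_le : ∃ c : ℝ, 0 ≤ c ∧ ∀ n K,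
    |(TcountEval (n + 2) K (fun _ => true) : ℝ) -
      (((shapes (n + 3)).card : ℝ) / 4 - (shapes (n + 2)).card / 2) *
        (labelings (n + 1) K).card| ≤ c * (shapes (n + 2)).card * (labelings n K).card := by
  classical
  obtain ⟨c, hc, h⟩ := Shape.sum_card_fullPattern_pow_bounded 4
  refine ⟨c, hc, fun n K => ?_⟩
  rw [TcountEval_true, ← Shape.sum_card_orLeaves_pairs (n := n + 2) (by omega), Finset.sum_mul,
    ← Finset.sum_sub_distrib]
  refine (Finset.abs_sum_le_sum_abs _ _).trans
    (le_trans (Finset.sum_le_sum (g := fun s => (s.fullPattern.card : ℝ) ^ 4 *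
      (labelings n K).card) fun s hs => ?_) ?_)
  · rw [mem_shapes] at hs
    have hO : ∀ i ∈ s.orLeaves, i < n + 1 + 1 := fun i hi => by
      have := s.lt_size_of_mem_orLeaves i hi
      omega
    have hF : ∀ i ∈ s.fullPattern, i < n + 2 := fun i hi => hs ▸ s.lt_size_of_mem_fullPattern i hi
    rw [← sum_card_oppositePairs hO, ← Finset.sum_sub_distrib]
    refine (Finset.abs_sum_le_sum_abs _ _).trans
      ((Finset.sum_le_sum fun l _ => ?_).trans (sum_card_offDiag_oppositePairs_le hF))
    exact abs_indicator_tautological_sub_le s (litAt l)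
  · rw [← Finset.sum_mul]
    exact mul_le_mul_of_nonneg_right (h (n + 2)) (Nat.cast_nonneg _)

theorem tendsto_card_shapes_ratio :
    Tendsto (fun n => ((shapes (n + 1)).card : ℝ) / (shapes n).card) atTop (nhds 8) := by
  simpa only [coeff_shapeGF] using tendsto_coeff_shapeGF_ratio

theorem card_shapes_pos {n : ℕ} (hn : 1 ≤ n) : (0 : ℝ) < (shapes n).card := by
  simpa only [coeff_shapeGF] using coeff_shapeGF_pos hn

theorem tendsto_TcountEval_true {k : ℕ → ℕ} (hk_pos : ∀ n, 1 ≤ n → 1 ≤ k n)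
    (hk_tend : Tendsto k atTop atTop) :
    Tendsto (fun n => (TcountEval n (k n) (fun _ => true) : ℝ) / (Tcount n (k n) : ℝ) / rat k n)
      atTop (nhds (3 / 4)) := by
  obtain ⟨c, hc, h⟩ := abs_TcountEval_true_sub_le
  rw [← tendsto_add_atTop_iff_nat 2]
  have hmain : Tendsto (fun n : ℕ => (((shapes (n + 3)).card : ℝ) / (shapes (n + 2)).card / 4 -
      1 / 2) / 2) atTop (nhds (3 / 4)) := by
    have := ((((tendsto_add_atTop_iff_nat 2).mpr tendsto_card_shapes_ratio).div_const 4).sub_const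
      (1 / 2)).div_const 2
    convert this using 2
    norm_num
  have herr : Tendsto (fun n : ℕ => c / 4 * (B n (k (n + 2)) / B (n + 1) (k (n + 2)))) atTop
      (nhds 0) := by
    simpa using (tendsto_B_div_B_succ (k := fun n => k (n + 2))
      ((tendsto_add_atTop_iff_nat 2).mpr hk_tend)).const_mul (c / 4)
  refine tendsto_of_tendsto_of_dist hmain
    (squeeze_zero' (Eventually.of_forall fun _ => dist_nonneg) ?_ herr)
  filter_upwards [eventually_ge_atTop 1] with n hn
  have hT := h n (k (n + 2))
  have hq := card_shapes_pos (n := n + 2) (by omega)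
  have hK := hk_pos (n + 2) (by omega)
  have h0 := B_pos hn hK
  have h1 := B_pos (n := n + 1) (by omega) hK
  have h2 := B_pos (n := n + 2) (by omega) hK
  rw [card_labelings (by omega), card_labelings hn] at hT
  rw [dist_comm, Real.dist_eq, Tcount_eq, Nat.cast_mul, card_labelings (by omega), rat,
    Nat.add_succ_sub_one]
  set K := k (n + 2)
  set q := ((shapes (n + 2)).card : ℝ)
  set T := (TcountEval (n + 2) K (fun _ => true) : ℝ)
  have hpos : 0 < q * 2 ^ (n + 2) * B (n + 1) K := by positivity
  have hrw : T / (q * (2 ^ (n + 2) * B (n + 2) K)) / (B (n + 1) K / B (n + 2) K) -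
      (((shapes (n + 3)).card : ℝ) / q / 4 - 1 / 2) / 2 =
      (T - (((shapes (n + 3)).card : ℝ) / 4 - q / 2) * (2 ^ (n + 1) * B (n + 1) K)) /
        (q * 2 ^ (n + 2) * B (n + 1) K) := by
    field_simp
    ring
  rw [hrw, abs_div, abs_of_pos hpos, div_le_iff₀ hpos]
  refine hT.trans_eq ?_
  field_simp
  ring

/-- `P_n⟨false⟩ ∼ (3/4)·rat_n`, and by duality
`P_n⟨true⟩ ∼ (3/4)·rat_n`. -/
theorem stmt_13 (k : ℕ → ℕ) (hk_mono : Monotone k)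
    (hk_pos : ∀ n, 1 ≤ n → 1 ≤ k n) (hk_le : ∀ n, 1 ≤ n → k n ≤ n)
    (hk_tend : Tendsto k atTop atTop) :
    Tendsto
      (fun n => (TcountEval n (k n) (fun _ => false) : ℝ) / (Tcount n (k n) : ℝ)
        / rat k n)
      atTop (nhds (3 / 4)) ∧
    Tendsto
      (fun n => (TcountEval n (k n) (fun _ => true) : ℝ) / (Tcount n (k n) : ℝ)
        / rat k n)
      atTop (nhds (3 / 4)) := by
  have h := tendsto_TcountEval_true hk_pos hk_tend
  refine ⟨?_, h⟩
  simpa only [TcountEval_false] using h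

end CatalanSat
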